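/- Let G be a skeletal claw-free graph admitting a strange 2-join ((X1,Y1),(X2,Y2)), and let l be an integer with l ≥ γ_ℓ^j(H2). If G1 = G[V1] has a proper l-colouring, then G has a proper l-colouring. -/

import Mathlib

open SimpleGraph

namespace Paper

variable {V : Type*} {W : Type*}

/-- A graph is claw-free if no vertex has three pairwise nonadjacent neighbours. -/
def ClawFree (G : SimpleGraph V) : Prop :=
  ¬ ∃ (v a b c : V), G.Adj v a ∧ G.Adj v b ∧ G.Adj v c ∧
      ¬G.Adj a b ∧ ¬G.Adj a c ∧ ¬G.Adj b c ∧ a ≠ b ∧ a ≠ c ∧ b ≠ c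

/-- A graph is quasi-line if every neighbourhood is covered by two cliques. -/
def QuasiLine (G : SimpleGraph V) : Prop :=
  ∀ v : V, ∃ S T : Set V, G.IsClique S ∧ G.IsClique T ∧ G.neighborSet v ⊆ S ∪ T

/-- The clique number ω(G). -/
noncomputable def cliqueNum (G : SimpleGraph V) : ℕ :=
  sSup {n | ∃ s : Finset V, G.IsNClique n s}

/-- The clique number of the subgraph induced on a vertex set `S`. -/
noncomputable def cliqueNumOn (G : SimpleGraph V) (S : Set V) : ℕ :=
  sSup {n | ∃ s : Finset V, ↑s ⊆ S ∧ G.IsNClique n s}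

/-- ω(v): the maximum size of a clique containing `v`. -/
noncomputable def omegaAt (G : SimpleGraph V) (v : V) : ℕ :=
  sSup {n | ∃ s : Finset V, G.IsNClique n s ∧ v ∈ s}

/-- The degree of a vertex (as the cardinality of its neighbourhood). -/
noncomputable def degree' (G : SimpleGraph V) (v : V) : ℕ := (G.neighborSet v).ncard

/-- The maximum degree Δ(G). -/
noncomputable def maxDeg (G : SimpleGraph V) : ℕ := sSup {n | ∃ v : V, n = degree' G v}

/-- γ_ℓ(v) = ⌈(d(v)+1+ω(v))/2⌉. -/
noncomputable def gammaLocalAt (G : SimpleGraph V) (v : V) : ℕ :=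
  (degree' G v + 1 + omegaAt G v + 1) / 2

/-- γ_ℓ(G) = max over vertices of γ_ℓ(v). -/
noncomputable def gammaLocal (G : SimpleGraph V) : ℕ :=
  sSup {n | ∃ v : V, n = gammaLocalAt G v}

/-- The closed neighbourhood of a vertex. -/
def closedNbhd (G : SimpleGraph V) (v : V) : Set V := insert v (G.neighborSet v)

/-- The closed neighbourhood within an induced subgraph on `S`. -/
def closedNbhdOn (G : SimpleGraph V) (S : Set V) (v : V) : Set V := S ∩ closedNbhd G v

/-- A triad: three pairwise nonadjacent vertices. -/
def IsTriad (G : SimpleGraph V) (T : Finset V) : Prop :=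
  T.card = 3 ∧ ∀ u ∈ T, ∀ w ∈ T, u ≠ w → ¬G.Adj u w

/-- A good triad within the induced subgraph on `S`: every vertex of the induced subgraph
outside `T` has two neighbours in `T`, or a twin in `T`, or is trumped by a vertex of `T`. -/
def GoodTriadOn (G : SimpleGraph V) (S : Set V) (T : Finset V) : Prop :=
  ↑T ⊆ S ∧ IsTriad G T ∧
    ∀ v ∈ S, v ∉ T →
      (∃ t1 ∈ T, ∃ t2 ∈ T, t1 ≠ t2 ∧ G.Adj v t1 ∧ G.Adj v t2) ∨
      (∃ t ∈ T, closedNbhdOn G S v = closedNbhdOn G S t) ∨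
      (∃ t ∈ T, closedNbhdOn G S v ⊂ closedNbhdOn G S t)

/-- A good triad in `G`. -/
def GoodTriad (G : SimpleGraph V) (T : Finset V) : Prop := GoodTriadOn G Set.univ T

/-- A homogeneous pair of cliques within the induced subgraph on `S`. -/
def IsHomPairOn (G : SimpleGraph V) (S : Set V) (A B : Finset V) : Prop :=
  ↑A ⊆ S ∧ ↑B ⊆ S ∧ G.IsClique (↑A : Set V) ∧ G.IsClique (↑B : Set V) ∧
    A.Nonempty ∧ B.Nonempty ∧ Disjoint A B ∧ 3 ≤ A.card + B.card ∧
    ∀ v ∈ S, v ∉ A → v ∉ B →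
      ((∀ a ∈ A, G.Adj v a) ∨ (∀ a ∈ A, ¬G.Adj v a)) ∧
      ((∀ b ∈ B, G.Adj v b) ∨ (∀ b ∈ B, ¬G.Adj v b))

/-- A homogeneous pair of cliques in `G`. -/
def IsHomPair (G : SimpleGraph V) (A B : Finset V) : Prop := IsHomPairOn G Set.univ A B

/-- A homogeneous pair of cliques `(A,B)` is skeletal if deleting any single edge
between `A` and `B` strictly decreases the clique number of `G[A ∪ B]`. -/
def IsSkeletalPair (G : SimpleGraph V) (A B : Finset V) : Prop :=
  ∀ a ∈ A, ∀ b ∈ B, G.Adj a b →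
    cliqueNumOn (G.deleteEdges {s(a, b)}) (↑A ∪ ↑B) < cliqueNumOn G (↑A ∪ ↑B)

/-- A graph is skeletal if every homogeneous pair of cliques in it is skeletal. -/
def Skeletal (G : SimpleGraph V) : Prop :=
  ∀ A B : Finset V, IsHomPair G A B → IsSkeletalPair G A B

/-- A linear pair: no induced C₄ between `A` and `B`. -/
def IsLinearPair (G : SimpleGraph V) (A B : Finset V) : Prop :=
  ¬ ∃ a1 ∈ A, ∃ a2 ∈ A, ∃ b1 ∈ B, ∃ b2 ∈ B,
      G.Adj a1 b1 ∧ G.Adj a2 b2 ∧ ¬G.Adj a1 b2 ∧ ¬G.Adj a2 b1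

/-- A homogeneous clique. -/
def IsHomogeneousClique [Fintype V] (G : SimpleGraph V) (C : Finset V) : Prop :=
  G.IsClique (↑C : Set V) ∧ 2 ≤ C.card ∧ C.card ≤ Fintype.card V - 1 ∧
    ∀ v ∉ C, (∀ c ∈ C, G.Adj v c) ∨ (∀ c ∈ C, ¬G.Adj v c)

/-- `X` straddles the three-cliquing `(A,B,C)` if it meets more than one of `A`, `B`, `C`. -/
def Straddles (A B C : Set V) (X : Finset V) : Prop :=
  ((↑X ∩ A).Nonempty ∧ (↑X ∩ B).Nonempty) ∨
  ((↑X ∩ A).Nonempty ∧ (↑X ∩ C).Nonempty) ∨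
  ((↑X ∩ B).Nonempty ∧ (↑X ∩ C).Nonempty)

/-- A three-cliqued graph is weakly skeletal if every nonskeletal homogeneous pair
of cliques is straddling. -/
def WeaklySkeletal (G : SimpleGraph V) (A B C : Set V) : Prop :=
  ∀ X Y : Finset V, IsHomPair G X Y → ¬IsSkeletalPair G X Y →
    Straddles A B C X ∨ Straddles A B C Y

/-- A set of unordered pairs forming a matching (pairwise disjoint non-loop pairs). -/
def IsMatchingSet (M : Set (Sym2 W)) : Prop :=
  (∀ e ∈ M, ¬e.IsDiag) ∧ ∀ e ∈ M, ∀ e' ∈ M, e ≠ e' → ∀ w : W, w ∈ e → w ∉ e'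

/-- `G[D]` is a thickening of `H[R]` under the matching `M`, via the fiber map `f`. -/
structure IsThickeningBetween (H : SimpleGraph W) (M : Set (Sym2 W)) (R : Set W)
    (G : SimpleGraph V) (D : Set V) (f : V → W) : Prop where
  maps_into : ∀ v ∈ D, f v ∈ R
  fibers_nonempty : ∀ w ∈ R, ∃ v ∈ D, f v = w
  fibers_clique : ∀ w : W, G.IsClique {v | v ∈ D ∧ f v = w}
  adj_of_adj : ∀ u ∈ D, ∀ v ∈ D, f u ≠ f v → H.Adj (f u) (f v) → s(f u, f v) ∉ M → G.Adj u v
  nonadj_of_nonadj : ∀ u ∈ D, ∀ v ∈ D, f u ≠ f v → ¬H.Adj (f u) (f v) → ¬G.Adj u v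
  semi_adj : ∀ x ∈ R, ∀ y ∈ R, s(x, y) ∈ M →
    ∃ u ∈ D, ∃ v ∈ D, f u = x ∧ f v = y ∧ G.Adj u v
  semi_nonadj : ∀ x ∈ R, ∀ y ∈ R, s(x, y) ∈ M →
    ∃ u ∈ D, ∃ v ∈ D, f u = x ∧ f v = y ∧ ¬G.Adj u v

/-- `G` is a thickening of `H[R]` under `M`. -/
def IsThickeningOn (H : SimpleGraph W) (M : Set (Sym2 W)) (R : Set W)
    (G : SimpleGraph V) (f : V → W) : Prop :=
  IsThickeningBetween H M R G Set.univ f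

/-- `G` is a thickening of `H` under `M`. -/
def IsThickening (H : SimpleGraph W) (M : Set (Sym2 W)) (G : SimpleGraph V) (f : V → W) : Prop :=
  IsThickeningBetween H M Set.univ G Set.univ f

/-- A graph is antiprismatic if every vertex outside a triad has exactly two
neighbours in it. -/
def Antiprismatic (H : SimpleGraph W) : Prop :=
  ∀ T : Finset W, IsTriad H T → ∀ v ∉ T,
    ∃ t ∈ T, ¬H.Adj v t ∧ ∀ t' ∈ T, t' ≠ t → H.Adj v t'

/-- A changeable matching in an antiprismatic graph. -/
def ChangeableMatching (H : SimpleGraph W) (M : Set (Sym2 W)) : Prop :=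
  M ⊆ H.edgeSet ∧ IsMatchingSet M ∧ ∀ M' ⊆ M, Antiprismatic (H.deleteEdges M')



/-- The icosahedron `G0` on vertices `v0, …, v11`. -/
def icoG0 : SimpleGraph (Fin 12) :=
  SimpleGraph.fromRel (fun i j =>
    (1 ≤ i.val ∧ i.val ≤ 10 ∧ (j.val = i.val % 10 + 1 ∨ j.val = (i.val + 1) % 10 + 1)) ∨
    (i.val = 0 ∧ j.val % 2 = 1 ∧ 1 ≤ j.val ∧ j.val ≤ 10) ∨
    (i.val = 11 ∧ j.val % 2 = 0 ∧ 1 ≤ j.val ∧ j.val ≤ 10))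

/-- `G1 = G0 − v11`. -/
def icoG1 : SimpleGraph (Fin 11) :=
  SimpleGraph.fromRel (fun i j =>
    (1 ≤ i.val ∧ (j.val = i.val % 10 + 1 ∨ j.val = (i.val + 1) % 10 + 1)) ∨
    (i.val = 0 ∧ j.val % 2 = 1))

/-- `G2 = G1 − v10`. -/
def icoG2 : SimpleGraph (Fin 10) :=
  SimpleGraph.fromRel (fun i j =>
    (1 ≤ i.val ∧ (j.val = i.val % 10 + 1 ∨ j.val = (i.val + 1) % 10 + 1)) ∨
    (i.val = 0 ∧ j.val % 2 = 1))

/-- An icosahedral thickening: a proper thickening of `G0` or `G1`, or a thickening of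
`G2 ∪ M` under a matching `M ⊆ {v1v4, v6v9}`. -/
def IsIcosahedralThickening (G : SimpleGraph V) : Prop :=
  (∃ f : V → Fin 12, IsThickening icoG0 ∅ G f) ∨
  (∃ f : V → Fin 11, IsThickening icoG1 ∅ G f) ∨
  (∃ (M : Set (Sym2 (Fin 10))) (f : V → Fin 10),
      M ⊆ {s((1 : Fin 10), 4), s(6, 9)} ∧
      IsThickening (icoG2 ⊔ SimpleGraph.fromEdgeSet M) M G f)

/-! ### Antihat graphs -/

/-- The vertex type of the antihat base graph: `A = {a0,…,ak}`, `B = {b0,…,bk}`,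
`C = {c1,…,ck}` (the third component `i` encodes `c_{i+1}`). -/
abbrev AHV (k : ℕ) : Type := Fin (k + 1) ⊕ Fin (k + 1) ⊕ Fin k

def ahA {k : ℕ} (i : Fin (k + 1)) : AHV k := Sum.inl i
def ahB {k : ℕ} (i : Fin (k + 1)) : AHV k := Sum.inr (Sum.inl i)
def ahC {k : ℕ} (i : Fin k) : AHV k := Sum.inr (Sum.inr i)

/-- The antihat base graph `H`, where `e00` records whether `a0` and `b0` are adjacent. -/
def antihatH (k : ℕ) (e00 : Bool) : SimpleGraph (AHV k) :=
  SimpleGraph.fromRel (fun x y =>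
    match x, y with
    | Sum.inl _, Sum.inl _ => True
    | Sum.inr (Sum.inl _), Sum.inr (Sum.inl _) => True
    | Sum.inr (Sum.inr _), Sum.inr (Sum.inr _) => True
    | Sum.inl i, Sum.inr (Sum.inl j) =>
        (i = j ∧ 1 ≤ i.val) ∨ (i.val = 0 ∧ j.val = 0 ∧ e00 = true)
    | Sum.inl i, Sum.inr (Sum.inr j) => 1 ≤ i.val ∧ i.val ≠ j.val + 1
    | Sum.inr (Sum.inl i), Sum.inr (Sum.inr j) => 1 ≤ i.val ∧ i.val ≠ j.val + 1
    | _, _ => False)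

/-- The conditions on the matching `M` of an antihat thickening with deleted set `Xd`. -/
def AntihatM (k : ℕ) (e00 : Bool) (Xd : Finset (AHV k)) (M : Set (Sym2 (AHV k))) : Prop :=
  IsMatchingSet M ∧
  (∀ e ∈ M, ∀ w : AHV k, w ∈ e → w ∉ Xd) ∧
  (∀ i j : Fin (k + 1), s(ahA i, ahA j) ∉ M) ∧
  (∀ i j : Fin (k + 1), s(ahB i, ahB j) ∉ M) ∧
  (∀ i j : Fin k, s(ahC i, ahC j) ∉ M) ∧
  (e00 = true → s(ahA (0 : Fin (k + 1)), ahB (0 : Fin (k + 1))) ∈ M) ∧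
  (∀ i j : Fin (k + 1), 1 ≤ i.val → 1 ≤ j.val → s(ahA i, ahB j) ∈ M →
      i = j ∧ ∃ c : Fin k, c.val + 1 = i.val ∧ ahC c ∈ Xd) ∧
  (∀ i : Fin (k + 1), ∀ j : Fin k, 1 ≤ i.val → s(ahB i, ahC j) ∈ M →
      i.val = j.val + 1 ∧ ahA i ∈ Xd) ∧
  (∀ i : Fin (k + 1), ∀ j : Fin k, 1 ≤ i.val → s(ahA i, ahC j) ∈ M →
      i.val = j.val + 1 ∧ ahB i ∈ Xd)

/-! ### Strips and generalized 2-joins -/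

/-- The induced subgraph on `S` contains an induced `W5` (a 5-wheel). -/
def HasInducedW5On (G : SimpleGraph V) (S : Set V) : Prop :=
  ∃ w c0 c1 c2 c3 c4 : V,
    w ∈ S ∧ c0 ∈ S ∧ c1 ∈ S ∧ c2 ∈ S ∧ c3 ∈ S ∧ c4 ∈ S ∧
    G.Adj w c0 ∧ G.Adj w c1 ∧ G.Adj w c2 ∧ G.Adj w c3 ∧ G.Adj w c4 ∧
    G.Adj c0 c1 ∧ G.Adj c1 c2 ∧ G.Adj c2 c3 ∧ G.Adj c3 c4 ∧ G.Adj c4 c0 ∧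
    c0 ≠ c2 ∧ c0 ≠ c3 ∧ c1 ≠ c3 ∧ c1 ≠ c4 ∧ c2 ≠ c4 ∧
    ¬G.Adj c0 c2 ∧ ¬G.Adj c0 c3 ∧ ¬G.Adj c1 c3 ∧ ¬G.Adj c1 c4 ∧ ¬G.Adj c2 c4

/-- A generalized 2-join `((X1,Y1),(X2,Y2))` of `G` separating `V1` from `V2`,
with `X1, X2, Y1, Y2` pairwise disjoint except possibly `X1` and `Y1`. -/
structure IsGen2Join [Fintype V] [DecidableEq V] (G : SimpleGraph V)
    (V1 V2 X1 Y1 X2 Y2 : Finset V) : Prop where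
  disjV : Disjoint V1 V2
  unionV : V1 ∪ V2 = Finset.univ
  subX1 : X1 ⊆ V1
  subY1 : Y1 ⊆ V1
  subX2 : X2 ⊆ V2
  subY2 : Y2 ⊆ V2
  cliqueX : G.IsClique (↑X1 ∪ ↑X2 : Set V)
  cliqueY : G.IsClique (↑Y1 ∪ ↑Y2 : Set V)
  cross : ∀ u ∈ V1, ∀ v ∈ V2, G.Adj u v → (u ∈ X1 ∧ v ∈ X2) ∨ (u ∈ Y1 ∧ v ∈ Y2)
  disjX2Y2 : Disjoint X2 Y2

/-- ω'(v): the maximum size of a clique of `H2 = G[V2 ∪ X1 ∪ Y1]` containing `v`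
and not intersecting both `X1 ∖ Y1` and `Y1 ∖ X1`. -/
noncomputable def omegaJ [DecidableEq V] (G : SimpleGraph V) (V2 X1 Y1 : Finset V) (v : V) : ℕ :=
  sSup {n | ∃ s : Finset V, G.IsNClique n s ∧ v ∈ s ∧ s ⊆ V2 ∪ X1 ∪ Y1 ∧
      ¬((∃ x ∈ s, x ∈ X1 ∧ x ∉ Y1) ∧ ∃ y ∈ s, y ∈ Y1 ∧ y ∉ X1)}

/-- γ_ℓ^j(H2) = max over `v ∈ V2 ∪ X1 ∪ Y1` of ⌈(d_G(v)+1+ω'(v))/2⌉. -/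
noncomputable def gammaLJ [DecidableEq V] (G : SimpleGraph V) (V2 X1 Y1 : Finset V) : ℕ :=
  (V2 ∪ X1 ∪ Y1).sup fun v => (degree' G v + 1 + omegaJ G V2 X1 Y1 v + 1) / 2

/-- `(G[V2], X2, Y2)` is an antihat strip. -/
def IsAntihatStripOn (G : SimpleGraph V) (V2 X2 Y2 : Finset V) : Prop :=
  ∃ (k : ℕ) (e00 : Bool) (Xd : Finset (AHV k)) (M : Set (Sym2 (AHV k))) (f : V → AHV k),
    2 ≤ k ∧ ahA (0 : Fin (k + 1)) ∉ Xd ∧ ahB (0 : Fin (k + 1)) ∉ Xd ∧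
    (∃ i j : Fin k, i ≠ j ∧ ahC i ∉ Xd ∧ ahC j ∉ Xd) ∧
    AntihatM k e00 Xd M ∧
    IsThickeningBetween (antihatH k e00 ⊔ SimpleGraph.fromEdgeSet M) M
      ((↑Xd ∪ {ahA (0 : Fin (k + 1)), ahB (0 : Fin (k + 1))} : Set (AHV k))ᶜ)
      G (↑V2 : Set V) f ∧
    (↑X2 : Set V) = {v | v ∈ V2 ∧ ∃ i : Fin (k + 1), 1 ≤ i.val ∧ f v = ahA i ∧ ahA i ∉ Xd} ∧
    (↑Y2 : Set V) = {v | v ∈ V2 ∧ ∃ i : Fin (k + 1), 1 ≤ i.val ∧ f v = ahB i ∧ ahB i ∉ Xd} ∧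
    HasInducedW5On G (↑V2 : Set V)

/-- The base graph of strange strips, on `a1=0, a2=1, b1=2, b2=3, b3=4, c1=5, c2=6`. -/
def strangeH : SimpleGraph (Fin 7) :=
  SimpleGraph.fromEdgeSet
    {s(0, 1), s(2, 3), s(2, 4), s(3, 4), s(5, 6),
     s(0, 2), s(1, 5), s(3, 5), s(4, 5), s(0, 6), s(1, 6), s(2, 6), s(3, 6)}

/-- The matching `{b3c1, b2c2}` of strange strips. -/
def strangeM : Set (Sym2 (Fin 7)) := {s(4, 5), s(3, 6)}

/-- `(G[V2], X2, Y2)` is a strange strip. -/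
def IsStrangeStripOn (G : SimpleGraph V) (V2 X2 Y2 : Finset V) : Prop :=
  ∃ f : V → Fin 7,
    IsThickeningBetween strangeH strangeM Set.univ G (↑V2 : Set V) f ∧
    (↑X2 : Set V) = {v | v ∈ V2 ∧ (f v = 0 ∨ f v = 1)} ∧
    (↑Y2 : Set V) = {v | v ∈ V2 ∧ (f v = 2 ∨ f v = 3 ∨ f v = 4)}

/-- The base graph of gear strips, on `v1, …, v10` (as `0, …, 9`). -/
def gearH : SimpleGraph (Fin 10) :=
  SimpleGraph.fromEdgeSet
    {s(0, 1), s(1, 2), s(2, 3), s(3, 4), s(4, 5), s(0, 5),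
     s(6, 0), s(6, 1), s(6, 2), s(6, 5),
     s(7, 2), s(7, 3), s(7, 4), s(7, 5), s(7, 6),
     s(8, 0), s(8, 2), s(8, 3), s(8, 5), s(8, 6), s(8, 7),
     s(9, 1), s(9, 2), s(9, 4), s(9, 5), s(9, 6), s(9, 7)}

/-- `(G[V2], X2, Y2)` is a gear strip. -/
def IsGearStripOn (G : SimpleGraph V) (V2 X2 Y2 : Finset V) : Prop :=
  ∃ (Xd : Finset (Fin 10)) (M : Set (Sym2 (Fin 10))) (f : V → Fin 10),
    Xd ⊆ {8, 9} ∧ M ⊆ {s((6 : Fin 10), 7)} ∧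
    IsThickeningBetween gearH M ((↑Xd : Set (Fin 10))ᶜ) G (↑V2 : Set V) f ∧
    (↑X2 : Set V) = {v | v ∈ V2 ∧ (f v = 0 ∨ f v = 1)} ∧
    (↑Y2 : Set V) = {v | v ∈ V2 ∧ (f v = 3 ∨ f v = 4)}

/-! ### The two exceptional three-cliqued classes -/

/-- The base graph of Exception I, on `v1, …, v8` (as `0, …, 7`);
`b` records whether `v2v5` is an edge. -/
def exIG (b : Bool) : SimpleGraph (Fin 8) :=
  SimpleGraph.fromEdgeSet
    ({s(0, 1), s(0, 2), s(0, 5), s(0, 6), s(1, 2), s(1, 3), s(2, 3), s(2, 4), s(3, 4),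
      s(3, 5), s(4, 5), s(5, 6), s(6, 7)} ∪ (if b then {s(1, 4)} else ∅))

/-- The matching of Exception I: `{v1v4, v3v6}`, plus `v2v5` when present. -/
def exIM (b : Bool) : Set (Sym2 (Fin 8)) :=
  {s(0, 3), s(2, 5)} ∪ (if b then {s(1, 4)} else ∅)

/-- The base graph of Exception II, on `v1, …, v9` (as `0, …, 8`); `b24` records
whether `v2v4` is an edge and `b75` whether `v7v5` is an edge. -/
def exIIG (b24 b75 : Bool) : SimpleGraph (Fin 9) :=
  SimpleGraph.fromEdgeSet
    ({s(0, 1), s(6, 7),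
      s(2, 3), s(2, 4), s(2, 5), s(2, 8), s(3, 4), s(3, 5), s(3, 8), s(4, 5), s(4, 8), s(5, 8),
      s(0, 2), s(0, 7), s(0, 8), s(5, 7), s(7, 8), s(1, 2), s(5, 6)}
      ∪ (if b24 then {s(1, 3)} else ∅) ∪ (if b75 then {s(4, 6)} else ∅))

/-! ### Circular interval representations -/

/-- Membership in the (closed) arc from `s` to `t` of the circle `[0,1)`,
going in increasing direction and possibly wrapping around. -/
def ArcMem (s t x : ℝ) : Prop := if s ≤ t then s ≤ x ∧ x ≤ t else (s ≤ x ∨ x ≤ t)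


theorem bdd_cliqueOn [Fintype V] (G : SimpleGraph V) (S : Set V) :
    BddAbove {n | ∃ s : Finset V, ↑s ⊆ S ∧ G.IsNClique n s} := by
  refine ⟨Fintype.card V, ?_⟩
  rintro n ⟨s, -, hs⟩
  rw [← hs.card_eq]; exact Finset.card_le_univ s

/-- Structure of a skeletal pair of cliques. -/
theorem skelPair [Fintype V] [DecidableEq V] (G : SimpleGraph V) (B C : Finset V)
    (hB : G.IsClique (↑B : Set V)) (hC : G.IsClique (↑C : Set V)) (hd : Disjoint B C)
    (hsk : IsSkeletalPair G B C) (he : ∃ b ∈ B, ∃ c ∈ C, G.Adj b c) :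
    ∃ B' C' : Finset V, B' ⊆ B ∧ C' ⊆ C ∧ (∀ b ∈ B', ∀ c ∈ C', G.Adj b c) ∧
      (∀ b ∈ B, ∀ c ∈ C, G.Adj b c → b ∈ B' ∧ c ∈ C') ∧
      B.card ≤ B'.card + C'.card ∧ C.card ≤ B'.card + C'.card ∧ B'.Nonempty ∧ C'.Nonempty := by
  have hne : {n | ∃ s : Finset V, ↑s ⊆ (↑B ∪ ↑C : Set V) ∧ G.IsNClique n s}.Nonempty :=
    ⟨B.card, B, Set.subset_union_left, hB, rfl⟩
  obtain ⟨K, hK, hKc⟩ := Nat.sSup_mem hne (bdd_cliqueOn G _)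
  have hω : cliqueNumOn G (↑B ∪ ↑C) = K.card := hKc.card_eq.symm
  have hmax : ∀ s : Finset V, ↑s ⊆ (↑B ∪ ↑C : Set V) → G.IsClique (↑s : Set V) →
      s.card ≤ K.card := by
    intro s hs hs'
    rw [← hω]
    exact le_csSup (bdd_cliqueOn G _) ⟨s, hs, hs', rfl⟩
  have hed : ∀ b ∈ B, ∀ c ∈ C, G.Adj b c → b ∈ K ∧ c ∈ K := by
    intro b hb c hc hbc
    by_contra hcon
    have h1 := hsk b hb c hc hbc
    rw [hω] at h1
    have h2 : K.card ≤ cliqueNumOn (G.deleteEdges {s(b, c)}) (↑B ∪ ↑C) := by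
      refine le_csSup (bdd_cliqueOn _ _) ⟨K, hK, ?_, rfl⟩
      intro u hu w hw huw
      rw [SimpleGraph.deleteEdges_adj]
      refine ⟨hKc.isClique hu hw huw, ?_⟩
      intro h
      rw [Set.mem_singleton_iff, Sym2.eq_iff] at h
      rcases h with ⟨rfl, rfl⟩ | ⟨rfl, rfl⟩
      · exact hcon ⟨hu, hw⟩
      · exact hcon ⟨hw, hu⟩
    omega
  have hcard : K.card = (B ∩ K).card + (C ∩ K).card := by
    rw [← Finset.card_union_of_disjoint]
    · congr 1
      ext z
      simp only [Finset.mem_union, Finset.mem_inter]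
      constructor
      · intro hz
        rcases hK hz with h | h
        · exact Or.inl ⟨h, hz⟩
        · exact Or.inr ⟨h, hz⟩
      · tauto
    · exact Finset.disjoint_of_subset_left Finset.inter_subset_left
        (Finset.disjoint_of_subset_right Finset.inter_subset_left hd)
  obtain ⟨b, hb, c, hc, hbc⟩ := he
  refine ⟨B ∩ K, C ∩ K, Finset.inter_subset_left, Finset.inter_subset_left, ?_, ?_, ?_, ?_,
    ⟨b, ?_⟩, ⟨c, ?_⟩⟩
  · intro b hb c hc
    rw [Finset.mem_inter] at hb hc
    refine hKc.isClique hb.2 hc.2 ?_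
    rintro rfl
    exact Finset.disjoint_left.mp hd hb.1 hc.1
  · intro b hb c hc hbc
    have := hed b hb c hc hbc
    exact ⟨Finset.mem_inter.mpr ⟨hb, this.1⟩, Finset.mem_inter.mpr ⟨hc, this.2⟩⟩
  · rw [← hcard]; exact hmax B Set.subset_union_left hB
  · rw [← hcard]; exact hmax C Set.subset_union_right hC
  · exact Finset.mem_inter.mpr ⟨hb, (hed b hb c hc hbc).1⟩
  · exact Finset.mem_inter.mpr ⟨hc, (hed b hb c hc hbc).2⟩

/-- The degree and clique bound at a vertex given by `γ_ℓ^j`. -/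
theorem bound [Fintype V] [DecidableEq V] (G : SimpleGraph V) (V2 X1 Y1 : Finset V) (l : ℕ)
    (hl : gammaLJ G V2 X1 Y1 ≤ l) (v : V) (hv : v ∈ V2 ∪ X1 ∪ Y1) (N s : Finset V)
    (hN : v ∈ N) (hadj : ∀ u ∈ N, u ≠ v → G.Adj v u)
    (hs : G.IsClique (↑s : Set V)) (hvs : v ∈ s) (hsub : s ⊆ V2 ∪ X1 ∪ Y1)
    (hnot : (∀ u ∈ s, u ∈ X1 → u ∈ Y1) ∨ (∀ u ∈ s, u ∈ Y1 → u ∈ X1)) :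
    N.card + s.card ≤ 2 * l := by
  have h1 : (degree' G v + 1 + omegaJ G V2 X1 Y1 v + 1) / 2 ≤ l :=
    (Finset.le_sup (f := fun v => (degree' G v + 1 + omegaJ G V2 X1 Y1 v + 1) / 2) hv).trans hl
  have h2 : s.card ≤ omegaJ G V2 X1 Y1 v := by
    apply le_csSup
    · refine ⟨Fintype.card V, ?_⟩
      rintro n ⟨t, ht, -⟩
      rw [← ht.card_eq]; exact Finset.card_le_univ t
    · refine ⟨s, ⟨hs, rfl⟩, hvs, hsub, ?_⟩
      rintro ⟨⟨x, hx, hx1, hx2⟩, ⟨y, hy, hy1, hy2⟩⟩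
      rcases hnot with h | h
      · exact hx2 (h x hx hx1)
      · exact hy2 (h y hy hy1)
  have h3 : N.card ≤ degree' G v + 1 := by
    have e : (N.erase v).card ≤ degree' G v := by
      unfold degree'
      rw [← Set.ncard_coe_finset]
      apply Set.ncard_le_ncard _ (Set.toFinite _)
      intro u hu
      have hu' : u ∈ N.erase v := hu
      rw [Finset.mem_erase] at hu'
      exact hadj u hu'.2 hu'.1
    rw [Finset.card_erase_of_mem hN] at e
    omega
  omega

theorem card_foldr [DecidableEq V] (L : List (Finset V)) (h : L.Pairwise Disjoint) :
    (L.foldr (· ∪ ·) ∅).card = (L.map Finset.card).sum ∧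
      ∀ u, u ∈ L.foldr (· ∪ ·) ∅ ↔ ∃ S ∈ L, u ∈ S := by
  induction L with
  | nil => simp
  | cons S L ih =>
    rw [List.pairwise_cons] at h
    obtain ⟨i1, i2⟩ := ih h.2
    refine ⟨?_, ?_⟩
    · simp only [List.foldr_cons, List.map_cons, List.sum_cons]
      rw [Finset.card_union_of_disjoint, i1]
      rw [Finset.disjoint_left]
      intro u hu hu'
      obtain ⟨T, hT, huT⟩ := (i2 u).mp hu'
      exact Finset.disjoint_left.mp (h.1 T hT) hu huT
    · intro u
      simp only [List.foldr_cons, Finset.mem_union, i2, List.mem_cons, exists_eq_or_imp]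

/-- The vertex bound, with the neighbourhood and the clique given as lists of pieces. -/
theorem boundL [Fintype V] [DecidableEq V] (G : SimpleGraph V) (V2 X1 Y1 : Finset V) (l : ℕ)
    (hl : gammaLJ G V2 X1 Y1 ≤ l) (v : V) (LN Ls : List (Finset V))
    (hdN : LN.Pairwise Disjoint) (hN : ∃ S ∈ LN, v ∈ S)
    (hadj : ∀ S ∈ LN, ∀ u ∈ S, u ≠ v → G.Adj v u)
    (hs : ∃ S ∈ Ls, v ∈ S) (hcl : ∀ S ∈ Ls, G.IsClique (↑S : Set V))
    (hcl2 : Ls.Pairwise (fun S T => ∀ u ∈ S, ∀ w ∈ T, G.Adj u w))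
    (hsub : ∀ S ∈ Ls, S ⊆ V2 ∪ X1 ∪ Y1)
    (hnot : (∀ S ∈ Ls, ∀ u ∈ S, u ∈ X1 → u ∈ Y1) ∨ (∀ S ∈ Ls, ∀ u ∈ S, u ∈ Y1 → u ∈ X1)) :
    (LN.map Finset.card).sum + (Ls.map Finset.card).sum ≤ 2 * l := by
  have hds : Ls.Pairwise Disjoint := hcl2.imp (by
    intro S T h
    rw [Finset.disjoint_left]
    intro u hu hu'
    exact G.loopless.irrefl u (h u hu u hu'))
  obtain ⟨c1, m1⟩ := card_foldr LN hdN
  obtain ⟨c2, m2⟩ := card_foldr Ls hds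
  rw [← c1, ← c2]
  have hsub' : Ls.foldr (· ∪ ·) ∅ ⊆ V2 ∪ X1 ∪ Y1 := by
    intro u hu
    obtain ⟨S, hS, huS⟩ := (m2 u).mp hu
    exact hsub S hS huS
  refine bound G V2 X1 Y1 l hl v (hsub' ((m2 v).mpr hs)) _ _ ((m1 v).mpr hN) ?_ ?_
    ((m2 v).mpr hs) hsub' ?_
  · intro u hu
    obtain ⟨S, hS, huS⟩ := (m1 u).mp hu
    exact hadj S hS u huS
  · intro u hu w hw huw
    obtain ⟨S, hS, huS⟩ := (m2 u).mp hu
    obtain ⟨T, hT, hwT⟩ := (m2 w).mp hw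
    by_cases hST : S = T
    · subst hST
      exact hcl S hS huS hwT huw
    · have : Std.Symm (fun S T : Finset V => ∀ u ∈ S, ∀ w ∈ T, G.Adj u w) :=
        ⟨by intro S T h u hu w hw; exact (h w hw u hu).symm⟩
      have := hcl2.forall hS hT hST
      exact this u huS w hwT
  · rcases hnot with h | h
    · left
      intro u hu
      obtain ⟨S, hS, huS⟩ := (m2 u).mp hu
      exact h S hS u huS
    · right
      intro u hu
      obtain ⟨S, hS, huS⟩ := (m2 u).mp hu
      exact h S hS u huS

/-- `col` is proper on `V1`. -/
def ProperOn (G : SimpleGraph V) (V1 : Finset V) {l : ℕ} (col : V → Fin l) : Prop :=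
  ∀ u ∈ V1, ∀ v ∈ V1, G.Adj u v → col u ≠ col v

theorem injOn_of_clique (G : SimpleGraph V) (V1 X : Finset V) {l : ℕ} (col : V → Fin l)
    (hp : ProperOn G V1 col) (hX : X ⊆ V1) (hc : G.IsClique (↑X : Set V)) :
    Set.InjOn col (↑X : Set V) := by
  intro u hu v hv huv
  by_contra hne
  exact hp u (hX hu) v (hX hv) (hc hu hv hne) huv

/-- One recolouring step at a vertex `u` of `X`, or a lower bound on its degree. -/
theorem recolourStep [Fintype V] [DecidableEq V] (G : SimpleGraph V) (V1 X Y : Finset V) {l : ℕ}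
    (col : V → Fin l) (hp : ProperOn G V1 col) (hX : X ⊆ V1)
    (hXc : G.IsClique (↑X : Set V)) (u : V) (hu : u ∈ X) (huY : u ∉ Y)
    (hc : col u ∈ Y.image col) :
    (∃ col' : V → Fin l, ProperOn G V1 col' ∧
      (X.image col' ∩ Y.image col').card < (X.image col ∩ Y.image col).card) ∨
    ∃ N : Finset V, (∀ w ∈ N, G.Adj u w ∧ w ∈ V1 ∧ w ∉ X) ∧
      N.card = ((X.image col ∪ Y.image col)ᶜ).card := by
  by_cases h : ∃ c ∈ (X.image col ∪ Y.image col)ᶜ, ∀ w ∈ V1, G.Adj u w → col w ≠ c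
  · left
    obtain ⟨c, hcF, hcn⟩ := h
    rw [Finset.mem_compl, Finset.mem_union, not_or] at hcF
    refine ⟨Function.update col u c, ?_, ?_⟩
    · intro w hw z hz hwz
      by_cases h1 : w = u
      · subst h1
        have h2 : z ≠ w := hwz.ne'
        rw [Function.update_self, Function.update_of_ne h2]
        exact (hcn z hz hwz).symm
      · rw [Function.update_of_ne h1]
        by_cases h2 : z = u
        · subst h2
          rw [Function.update_self]
          exact hcn w hw hwz.symm
        · rw [Function.update_of_ne h2]
          exact hp w hw z hz hwz
    · apply Finset.card_lt_card
      have hYim : Y.image (Function.update col u c) = Y.image col := by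
        apply Finset.image_congr
        intro w hw
        exact Function.update_of_ne (fun h : w = u => huY (h ▸ hw)) _ _
      rw [hYim, Finset.ssubset_iff_of_subset]
      · refine ⟨col u, Finset.mem_inter.mpr ⟨Finset.mem_image_of_mem _ hu, hc⟩, ?_⟩
        intro hcon
        obtain ⟨w, hw, hwe⟩ := Finset.mem_image.mp (Finset.mem_inter.mp hcon).1
        by_cases h1 : w = u
        · subst h1
          rw [Function.update_self] at hwe
          exact hcF.2 (hwe ▸ hc)
        · rw [Function.update_of_ne h1] at hwe
          exact h1 (injOn_of_clique G V1 X col hp hX hXc hw hu hwe)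
      · intro d hd
        rw [Finset.mem_inter] at hd ⊢
        refine ⟨?_, hd.2⟩
        obtain ⟨w, hw, hwe⟩ := Finset.mem_image.mp hd.1
        by_cases h1 : w = u
        · subst h1
          rw [Function.update_self] at hwe
          exact absurd (hwe ▸ hd.2) hcF.2
        · rw [Function.update_of_ne h1] at hwe
          exact hwe ▸ Finset.mem_image_of_mem _ hw
  · right
    push Not at h
    have : Nonempty V := ⟨u⟩
    choose! g hg1 hg2 hg3 using h
    refine ⟨((X.image col ∪ Y.image col)ᶜ).image g, ?_, ?_⟩
    · intro w hw
      obtain ⟨c, hc', rfl⟩ := Finset.mem_image.mp hw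
      refine ⟨hg2 c hc', hg1 c hc', fun hX' => ?_⟩
      have := Finset.mem_image_of_mem col hX'
      rw [hg3 c hc'] at this
      rw [Finset.mem_compl, Finset.mem_union, not_or] at hc'
      exact hc'.1 this
    · apply Finset.card_image_of_injOn
      intro c hc' d hd hcd
      rw [← hg3 c hc', ← hg3 d hd, hcd]

/-- Choosing the colouring of `G1` with few colours common to `X` and `Y`. -/
theorem recolour [Fintype V] [DecidableEq V] (G : SimpleGraph V) (V1 X Y : Finset V) {l : ℕ}
    (hX : X ⊆ V1) (hXc : G.IsClique (↑X : Set V)) (hY : Y ⊆ V1) (hYc : G.IsClique (↑Y : Set V))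
    (a b a1 b1 : ℕ) (ha : a1 ≤ a) (hb : b1 ≤ b) (hz : a1 + b1 + (X ∩ Y).card ≤ l)
    (hU : ∀ u ∈ X, u ∉ Y → ∀ N : Finset V, (∀ w ∈ N, G.Adj u w ∧ w ∈ V1 ∧ w ∉ X) →
      2 * (X.card + a) + N.card ≤ 2 * l)
    (hV : ∀ u ∈ Y, u ∉ X → ∀ N : Finset V, (∀ w ∈ N, G.Adj u w ∧ w ∈ V1 ∧ w ∉ Y) →
      2 * (Y.card + b) + N.card ≤ 2 * l) :
    ∀ n : ℕ, ∀ col : V → Fin l, ProperOn G V1 col → (X.image col ∩ Y.image col).card = n →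
    ∃ col : V → Fin l, ProperOn G V1 col ∧ a1 + b1 + (X.image col ∩ Y.image col).card ≤ l := by
  intro n
  induction n using Nat.strong_induction_on with
  | _ n ih =>
  intro col hp hn
  by_cases hdone : a1 + b1 + (X.image col ∩ Y.image col).card ≤ l
  · exact ⟨col, hp, hdone⟩
  have h1 : ¬ (X.image col ∩ Y.image col ⊆ (X ∩ Y).image col) := by
    intro h
    have := Finset.card_le_card h
    have := Finset.card_image_le (s := X ∩ Y) (f := col)
    omega
  rw [Finset.not_subset] at h1
  obtain ⟨c, hc, hc'⟩ := h1
  rw [Finset.mem_inter] at hc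
  obtain ⟨u, hu, huc⟩ := Finset.mem_image.mp hc.1
  obtain ⟨v, hv, hvc⟩ := Finset.mem_image.mp hc.2
  have huY : u ∉ Y := fun h => hc' (huc ▸ Finset.mem_image_of_mem _ (Finset.mem_inter.mpr ⟨hu, h⟩))
  have hvX : v ∉ X := fun h => hc' (hvc ▸ Finset.mem_image_of_mem _ (Finset.mem_inter.mpr ⟨h, hv⟩))
  rcases recolourStep G V1 X Y col hp hX hXc u hu huY (huc ▸ hc.2) with ⟨col', p', l'⟩ | ⟨N, n1, n2⟩
  · exact ih _ (hn ▸ l') col' p' rfl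
  rcases recolourStep G V1 Y X col hp hY hYc v hv hvX (hvc ▸ hc.1) with ⟨col', p', l'⟩ | ⟨N', n1', n2'⟩
  · rw [Finset.inter_comm, Finset.inter_comm (Y.image col)] at l'
    exact ih _ (hn ▸ l') col' p' rfl
  exfalso
  have e1 := hU u hu huY N n1
  have e2 := hV v hv hvX N' n1'
  have e3 := Finset.card_add_card_compl (X.image col ∪ Y.image col)
  have e4 := Finset.card_union_add_card_inter (X.image col) (Y.image col)
  have e5 := Finset.card_image_of_injOn (injOn_of_clique G V1 X col hp hX hXc)
  have e6 := Finset.card_image_of_injOn (injOn_of_clique G V1 Y col hp hY hYc)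
  rw [Finset.union_comm] at n2'
  rw [Fintype.card_fin] at e3
  omega

set_option maxHeartbeats 4000000 in
theorem arith (a1 a2 b1 b2p b2q b3p b3q c1p c1q c2p c2q x y k l : ℕ)
    (s1 : b3q ≤ c1p) (s2 : c1q ≤ b3p) (s3 : b2q ≤ c2p) (s4 : c2q ≤ b2p)
    (hkx : k ≤ x) (hky : k ≤ y) (hf : x + y ≤ l + k) (hM : a1 + b1 + k ≤ l)
    (cl : a1 + b1 + (c2p + c2q) ≤ l)
    (I1 : 2 * (x + a1 + a2) + (c1p + c1q + c2p + c2q) ≤ 2 * l)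
    (I2 : 2 * (a1 + a2) + (c1p + c1q + c2p + c2q) + (c2p + c2q) ≤ 2 * l)
    (I3 : a1 + 2 * a2 + 2 * (c1p + c1q + c2p + c2q) ≤ 2 * l)
    (J1 : 2 * (y + b1 + b2p + b2q + b3p + b3q) + c1p + c1q + c2p ≤ 2 * l)
    (J3 : (b1 + b2p + b2q + b3p + b3q) + c1p + c1q + c2p + (b2p + c1p + c1q + c2p) ≤ 2 * l)
    (J4 : (b1 + b2p + b2q + b3p + b3q) + c1p + c1q + c2p + (b1 + b2p + c2p) ≤ 2 * l)
    (J5 : (b1 + b2p + b2q + b3p + b3q) + c1p + c1q + c2p + (b2p + b2q + b3p + c1p) ≤ 2 * l) :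
    ∃ α β1 β3 γ3 γ2 T : ℕ, α ≤ a1 ∧ α + β1 + β3 ≤ c1p + c1q ∧ β1 ≤ b1 ∧ β3 ≤ b3q + c1q ∧
      β3 + γ3 ≤ b3p + b3q ∧ γ2 ≤ b2q + c2q ∧ γ2 ≤ b2p + b2q ∧ γ2 + γ3 ≤ c2p + c2q ∧
      T + α ≤ a1 + a2 ∧ T + (β1 + β3 + γ3 + γ2) ≤ b1 + b2p + b2q + b3p + b3q ∧
      T + β3 + γ3 + γ2 ≤ a2 + b2p + b2q + b3p + b3q ∧
      T + x + y ≤ l + k ∧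
      a1 + a2 + (b1 + b2p + b2q + b3p + b3q) + k ≤ l + T ∧
      a1 + a2 + (b1 + b2p + b2q + b3p + b3q) + (c1p + c1q + c2p + c2q) ≤
        l + T + α + (β1 + β3 + γ3 + γ2) := by
  obtain ⟨a, ha⟩ : ∃ a, a = a1 + a2 := ⟨_, rfl⟩
  obtain ⟨b, hb⟩ : ∃ b, b = b1 + b2p + b2q + b3p + b3q := ⟨_, rfl⟩
  obtain ⟨c, hc⟩ : ∃ c, c = c1p + c1q + c2p + c2q := ⟨_, rfl⟩
  obtain ⟨α, hαl, hα0⟩ : ∃ α, a + c ≤ l + α ∧ (α = 0 ∨ α + l = a + c) := by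
    rcases le_total (a + c) l with h | h
    · exact ⟨0, by linarith, Or.inl rfl⟩
    · obtain ⟨d, hd⟩ := Nat.exists_eq_add_of_le h
      exact ⟨d, by linarith, Or.inr (by linarith)⟩
  have hα1 : α ≤ a1 := by rcases hα0 with h | h <;> linarith
  have hα2 : 2 * α ≤ c1p + c1q := by rcases hα0 with h | h <;> linarith
  obtain ⟨S, S1, S2, S3, S4⟩ : ∃ S, b + c ≤ l + S ∧ a + b + c + x + y ≤ 2 * l + k + S + α ∧
      a1 + b1 + c ≤ l + S + α ∧ (S = 0 ∨ b + c = l + S ∨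
        a + b + c + x + y = 2 * l + k + S + α ∨ a1 + b1 + c = l + S + α) := by
    clear I1 I2 I3 J1 J3 J4 J5 cl hM hf s1 s2 s3 s4 hα0 hα1 hα2 hαl ha hb hc
    generalize a + b + c + x + y = e1, 2 * l + k = e2, b + c = e3, a1 + b1 + c = e4
    refine ⟨max (e3 - l) (max (e1 - (e2 + α)) (e4 - (l + α))), ?_, ?_, ?_, ?_⟩ <;> omega
  obtain ⟨β1, p1, p2, p3, p4⟩ : ∃ β1, β1 ≤ S ∧ β1 ≤ b1 ∧ β1 + α ≤ c1p + c1q ∧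
      (β1 = S ∨ β1 = b1 ∨ β1 + α = c1p + c1q) := by
    clear S1 S2 S3 S4 I1 I2 I3 J1 J3 J4 J5 cl hM hf s1 s2 s3 s4
    refine ⟨min S (min b1 (c1p + c1q - α)), ?_, ?_, ?_, ?_⟩ <;> omega
  -- bounds for the number `S` of pairs between `B` and `C`
  have hU : 2 * (a + b + c + x + y) ≤ 2 * (2 * l + k) + c2q := by linarith
  have hR1 : S ≤ β1 + (b2q + c2q) + b3p + b3q := by
    rcases S4 with h | h | h | h
    · linarith
    · rcases p4 with h' | h' | h'
      · linarith
      · subst hb hc; linarith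
      · subst hb hc; linarith
    · linarith
    · rcases p4 with h' | h' | h'
      · linarith
      · linarith
      · linarith
  have hR2 : S ≤ β1 + c2p + c2q + (b3q + c1q) := by
    rcases S4 with h | h | h | h
    · linarith
    · rcases p4 with h' | h' | h' <;> linarith
    · linarith
    · rcases p4 with h' | h' | h' <;> linarith
  have hR3 : S + α ≤ c := by
    rcases S4 with h | h | h | h <;> linarith
  obtain ⟨β3, γ3, γ2, hS, q1, q2, q3, q4, q5⟩ : ∃ β3 γ3 γ2, S = β1 + β3 + γ3 + γ2 ∧
      β3 ≤ b3q + c1q ∧ α + β1 + β3 ≤ c1p + c1q ∧ β3 + γ3 ≤ b3p + b3q ∧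
      γ2 + γ3 ≤ c2p + c2q ∧ γ2 ≤ b2q + c2q := by
    clear S1 S2 S3 S4 I1 I2 I3 J1 J3 J4 J5 cl hM hf hα0 hU p4 ha hb
    obtain ⟨R, rfl⟩ : ∃ R, S = β1 + R := ⟨S - β1, by omega⟩
    rcases le_total R (b2q + c2q) with h | h
    · exact ⟨0, 0, R, by omega, by omega, by omega, by omega, by omega, by omega⟩
    · rcases le_total R (c2p + c2q) with h' | h'
      · exact ⟨0, R - (b2q + c2q), b2q + c2q, by omega, by omega, by omega, by omega, by omega,
          by omega⟩
      · exact ⟨R - (c2p + c2q), c2p - b2q, b2q + c2q, by omega, by omega, by omega, by omega,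
          by omega, by omega⟩
  have hd1 : a1 + b1 + c ≤ l + α + β1 := by
    clear hR1 hR2 hR3 q1 q2 q3 q4 q5 hS
    rcases p4 with h | h | h
    · linarith
    · linarith
    · linarith
  obtain ⟨T, t1, t2, t3⟩ : ∃ T, a + b + c ≤ l + α + S + T ∧ a + b + k ≤ l + T ∧
      (T = 0 ∨ T + (l + α + S) = a + b + c ∨ T + l = a + b + k) := by
    generalize a + b + c = e1, l + α + S = e2, a + b + k = e3
    clear * -
    refine ⟨max (e1 - e2) (e3 - l), ?_, ?_, ?_⟩ <;> omega
  refine ⟨α, β1, β3, γ3, γ2, T, hα1, q2, p2, q1, q3, q5, by linarith, q4, ?_, ?_, ?_, ?_, ?_, ?_⟩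
  · rcases t3 with h | h | h
    · linarith
    · linarith
    · rcases hα0 with h' | h' <;> linarith
  · rcases t3 with h | h | h
    · linarith
    · rcases hα0 with h' | h' <;> linarith
    · rcases S4 with h' | h' | h' | h' <;> linarith
  · rcases t3 with h | h | h
    · linarith
    · linarith
    · rcases S4 with h' | h' | h' | h' <;> linarith
  · rcases t3 with h | h | h <;> linarith
  · linarith
  · linarith

theorem exists_injOn_maps {V κ : Type*} [DecidableEq V] [DecidableEq κ] (d : κ) (B : Finset V) (Φ : Finset κ)
    (h : B.card = Φ.card) : ∃ g : V → κ, Set.InjOn g B ∧ ∀ v ∈ B, g v ∈ Φ := by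
  let e := Finset.equivOfCardEq h
  refine ⟨fun v => if hv : v ∈ B then (e ⟨v, hv⟩ : κ) else d, ?_, ?_⟩
  · intro u hu v hv huv
    have hu' : u ∈ B := hu
    have hv' : v ∈ B := hv
    simp only [hu', hv', dif_pos] at huv
    have := e.injective (Subtype.ext huv)
    simpa using this
  · intro v hv
    simp only [hv, dif_pos]
    exact (e ⟨v, hv⟩).2

/-- colouring a clique so that the part `Q` gets (at least) the colours `M`. -/
theorem exists_split {V κ : Type*} [DecidableEq V] [DecidableEq κ] (d : κ) (B Q : Finset V)
    (Φ M : Finset κ) (hQ : Q ⊆ B) (hM : M ⊆ Φ) (h : B.card = Φ.card) (hc : M.card ≤ Q.card) :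
    ∃ g : V → κ, Set.InjOn g B ∧ (∀ v ∈ B, g v ∈ Φ) ∧ ∀ v ∈ B, v ∉ Q → g v ∉ M := by
  obtain ⟨N, hMN, hN, cN⟩ := Finset.exists_subsuperset_card_eq hM hc
    (by rw [← h]; exact Finset.card_le_card hQ)
  have e1 := Finset.card_sdiff_add_card_eq_card hQ
  have e2 := Finset.card_sdiff_add_card_eq_card hN
  obtain ⟨g1, i1, m1⟩ := exists_injOn_maps d Q N cN.symm
  obtain ⟨g2, i2, m2⟩ := exists_injOn_maps d (B \ Q) (Φ \ N) (by omega)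
  have m2' : ∀ v ∈ B, v ∉ Q → g2 v ∈ Φ ∧ g2 v ∉ N := fun v hv hq =>
    Finset.mem_sdiff.mp (m2 v (Finset.mem_sdiff.mpr ⟨hv, hq⟩))
  refine ⟨fun v => if v ∈ Q then g1 v else g2 v, ?_, ?_, ?_⟩
  · intro u hu v hv huv
    have hu' : u ∈ B := hu
    have hv' : v ∈ B := hv
    by_cases hq : u ∈ Q <;> by_cases hr : v ∈ Q <;> simp only [hq, hr, if_true, if_false] at huv
    · exact i1 hq hr huv
    · exact absurd (huv ▸ m1 u hq) (m2' v hv' hr).2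
    · exact absurd (huv ▸ m1 v hr) (m2' u hu' hq).2
    · exact i2 (by simp [hu', hq]) (by simp [hv', hr]) huv
  · intro v hv
    by_cases hq : v ∈ Q <;> simp only [hq, if_true, if_false]
    · exact hN (m1 v hq)
    · exact (m2' v hv hq).1
  · intro v hv hq hm
    simp only [hq, if_false] at hm
    exact (m2' v hv hq).2 (hMN hm)

theorem refinePair {V κ : Type*} [DecidableEq V] [DecidableEq κ] (d : κ) (G : SimpleGraph V)
    (B C B' C' : Finset V) (Φ Ψ : Finset κ)
    (hadj : ∀ b ∈ B, ∀ c ∈ C, G.Adj b c → b ∈ B' ∧ c ∈ C')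
    (hB : B.card = Φ.card) (hC : C.card = Ψ.card)
    (hi : (Φ ∩ Ψ).card ≤ (B \ B').card + (C \ C').card) :
    ∃ g h : V → κ, Set.InjOn g B ∧ (∀ v ∈ B, g v ∈ Φ) ∧ Set.InjOn h C ∧ (∀ v ∈ C, h v ∈ Ψ) ∧
      ∀ b ∈ B, ∀ c ∈ C, G.Adj b c → g b ≠ h c := by
  obtain ⟨M, hM, cM⟩ : ∃ M ⊆ Φ ∩ Ψ, M.card = min (Φ ∩ Ψ).card (B \ B').card :=
    Finset.exists_subset_card_eq (by omega)
  have e := Finset.card_sdiff_add_card_eq_card hM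
  obtain ⟨g, g1, g2, g3⟩ := exists_split d B (B \ B') Φ M Finset.sdiff_subset
    (hM.trans Finset.inter_subset_left) hB (by omega)
  obtain ⟨h, h1, h2, h3⟩ := exists_split d C (C \ C') Ψ ((Φ ∩ Ψ) \ M) Finset.sdiff_subset
    (Finset.sdiff_subset.trans Finset.inter_subset_right) hC (by omega)
  refine ⟨g, h, g1, g2, h1, h2, ?_⟩
  intro b hb c hc hbc hgh
  obtain ⟨hb', hc'⟩ := hadj b hb c hc hbc
  have k1 := g3 b hb (by simp [hb'])
  have k2 := h3 c hc (by simp [hc'])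
  apply k2
  rw [← hgh, Finset.mem_sdiff, Finset.mem_inter]
  exact ⟨⟨g2 b hb, hgh ▸ h2 c hc⟩, k1⟩

/-- Choosing the colour sets used on each of the seven fibres of the strip. -/
theorem colourSets {κ : Type*} [Fintype κ] [DecidableEq κ] (CX CY : Finset κ)
    (a1 a2 b1 b2 b3 c1 c2 x y k l α β1 β3 γ3 γ2 T : ℕ)
    (hl : Fintype.card κ = l) (hx : CX.card = x) (hy : CY.card = y) (hk : (CX ∩ CY).card = k)
    (hax : x + a1 + a2 ≤ l) (hby : y + b1 + b2 + b3 ≤ l)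
    (h1 : α ≤ a1) (h2 : α + β1 + β3 ≤ c1) (h3 : β1 ≤ b1) (h5 : β3 + γ3 ≤ b3)
    (h7 : γ2 ≤ b2) (h8 : γ2 + γ3 ≤ c2) (h9 : T + α ≤ a1 + a2)
    (h10 : T + (β1 + β3 + γ3 + γ2) ≤ b1 + b2 + b3)
    (h11 : T + β3 + γ3 + γ2 ≤ a2 + b2 + b3)
    (h12 : T + x + y ≤ l + k) (h13 : a1 + a2 + (b1 + b2 + b3) + k ≤ l + T)
    (h14 : a1 + a2 + (b1 + b2 + b3) + (c1 + c2) ≤ l + T + α + (β1 + β3 + γ3 + γ2)) :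
    ∃ A1 A2 B1 B2 B3 C1 C2 : Finset κ,
      (A1.card = a1 ∧ A2.card = a2 ∧ B1.card = b1 ∧ B2.card = b2 ∧ B3.card = b3 ∧
        C1.card = c1 ∧ C2.card = c2) ∧
      (Disjoint A1 CX ∧ Disjoint A2 CX ∧ Disjoint B1 CY ∧ Disjoint B2 CY ∧ Disjoint B3 CY) ∧
      (Disjoint A1 A2 ∧ Disjoint B1 B2 ∧ Disjoint B1 B3 ∧ Disjoint B2 B3 ∧ Disjoint C1 C2) ∧
      (Disjoint A1 B1 ∧ Disjoint A2 C1 ∧ Disjoint B2 C1 ∧ Disjoint A1 C2 ∧ Disjoint A2 C2 ∧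
        Disjoint B1 C2) ∧
      (B3 ∩ C1).card ≤ β3 ∧ (B2 ∩ C2).card ≤ γ2 := by
  have hXY : (CX ∪ CY).card + k = x + y := by
    rw [← hk, ← hx, ← hy]; exact Finset.card_union_add_card_inter CX CY
  have hYX : (CY \ CX).card + k = y := by
    rw [← hk, ← hy, Finset.inter_comm]; exact Finset.card_sdiff_add_card_inter CY CX
  have hcc : ∀ s : Finset κ, sᶜ.card + s.card = l := by
    intro s; rw [← hl, add_comm]; exact Finset.card_add_card_compl s
  -- colours used by both `A` and `B`
  obtain ⟨PAB, sAB, cAB⟩ : ∃ P ⊆ (CX ∪ CY)ᶜ, P.card = T :=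
    Finset.exists_subset_card_eq (by have := hcc (CX ∪ CY); omega)
  have dABX : Disjoint PAB CX := by
    rw [Finset.disjoint_left]; intro z hz hz'; have := sAB hz; simp_all
  have dABY : Disjoint PAB CY := by
    rw [Finset.disjoint_left]; intro z hz hz'; have := sAB hz; simp_all
  -- colours used by `A` only
  obtain ⟨PA, sA, dA, cA, hPB⟩ : ∃ PA : Finset κ, Disjoint PA CX ∧ Disjoint PA PAB ∧
      PA.card + T = a1 + a2 ∧ b1 + b2 + b3 ≤ T + (CY ∪ PAB ∪ PA)ᶜ.card := by
    have e1 : (CX ∪ PAB).card = x + T := by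
      rw [Finset.card_union_of_disjoint dABX.symm, hx, cAB]
    have e2 : (CY ∪ PAB).card = y + T := by
      rw [Finset.card_union_of_disjoint dABY.symm, hy, cAB]
    rcases le_total (a1 + a2 - T) (CY \ CX).card with h | h
    · obtain ⟨P, sP, cP⟩ := Finset.exists_subset_card_eq h
      refine ⟨P, ?_, ?_, by omega, ?_⟩
      · rw [Finset.disjoint_left]; intro z hz hz'; have := sP hz; simp_all
      · rw [Finset.disjoint_left]; intro z hz hz'; have := sP hz
        exact (Finset.disjoint_left.mp dABY hz') (Finset.mem_sdiff.mp this).1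
      · have e3 : CY ∪ PAB ∪ P = CY ∪ PAB := by
          apply Finset.union_eq_left.mpr
          intro z hz; exact Finset.mem_union_left _ (Finset.mem_sdiff.mp (sP hz)).1
        rw [e3]; have := hcc (CY ∪ PAB); omega
    · have hsub : CY \ CX ⊆ (CX ∪ PAB)ᶜ := by
        intro z hz
        simp only [Finset.mem_sdiff, Finset.mem_compl, Finset.mem_union] at hz ⊢
        rintro (h' | h')
        · exact hz.2 h'
        · exact Finset.disjoint_left.mp dABY h' hz.1
      obtain ⟨P, sP1, sP2, cP⟩ := Finset.exists_subsuperset_card_eq hsub h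
        (by have := hcc (CX ∪ PAB); omega)
      refine ⟨P, ?_, ?_, by omega, ?_⟩
      · rw [Finset.disjoint_left]; intro z hz hz'; have := sP2 hz; simp_all
      · rw [Finset.disjoint_left]; intro z hz hz'; have := sP2 hz; simp_all
      · have e3 : CY ∪ PAB ∪ P = (CY ∪ PAB) ∪ (P \ (CY \ CX)) := by
          ext z; simp only [Finset.mem_union, Finset.mem_sdiff]; tauto
        have e4 : (P \ (CY \ CX)).card + (CY \ CX).card = P.card :=
          Finset.card_sdiff_add_card_eq_card sP1
        have e5 := Finset.card_union_le (CY ∪ PAB) (P \ (CY \ CX))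
        rw [← e3] at e5
        have := hcc (CY ∪ PAB ∪ P); omega
  obtain ⟨PB, sB, cB⟩ : ∃ P ⊆ (CY ∪ PAB ∪ PA)ᶜ, P.card = b1 + b2 + b3 - T :=
    Finset.exists_subset_card_eq (by omega)
  have dBY : Disjoint PB CY := by
    rw [Finset.disjoint_left]; intro z hz hz'; have := sB hz; simp_all
  have dBAB : Disjoint PB PAB := by
    rw [Finset.disjoint_left]; intro z hz hz'; have := sB hz; simp_all
  have dBA : Disjoint PB PA := by
    rw [Finset.disjoint_left]; intro z hz hz'; have := sB hz; simp_all
  clear sB sAB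
  have cU1 : (PAB ∪ PA).card = a1 + a2 := by
    rw [Finset.card_union_of_disjoint dA.symm]; omega
  have cU2 : (PAB ∪ PB).card = b1 + b2 + b3 := by
    rw [Finset.card_union_of_disjoint dBAB.symm]; omega
  have cU3 : (PAB ∪ PA ∪ PB).card + T = a1 + a2 + (b1 + b2 + b3) := by
    rw [Finset.card_union_of_disjoint (by
      rw [Finset.disjoint_union_left]; exact ⟨dBAB.symm, dBA.symm⟩)]; omega
  have cU0 := hcc (PAB ∪ PA ∪ PB)
  -- the pairs
  obtain ⟨Qα, sα, cα⟩ : ∃ P ⊆ PA, P.card = α := Finset.exists_subset_card_eq (by omega)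
  obtain ⟨Q1, s1, cq1⟩ : ∃ P ⊆ PB, P.card = β1 := Finset.exists_subset_card_eq (by omega)
  have d1 := Finset.card_sdiff_add_card_eq_card s1
  obtain ⟨Q3, s3, cq3⟩ : ∃ P ⊆ PB \ Q1, P.card = β3 := Finset.exists_subset_card_eq (by omega)
  have d3 := Finset.card_sdiff_add_card_eq_card s3
  obtain ⟨R3, s4, cq4⟩ : ∃ P ⊆ (PB \ Q1) \ Q3, P.card = γ3 :=
    Finset.exists_subset_card_eq (by omega)
  have d4 := Finset.card_sdiff_add_card_eq_card s4
  obtain ⟨R2, s5, cq5⟩ : ∃ P ⊆ ((PB \ Q1) \ Q3) \ R3, P.card = γ2 :=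
    Finset.exists_subset_card_eq (by omega)
  have hQ : (Q3 ∪ R3).card = β3 + γ3 := by
    rw [Finset.card_union_of_disjoint, cq3, cq4]
    rw [Finset.disjoint_left]; intro z hz hz'; have := s4 hz'; simp_all
  have hQ' : (Q3 ∪ R3 ∪ R2).card = β3 + γ3 + γ2 := by
    rw [Finset.card_union_of_disjoint, hQ, cq5]
    rw [Finset.disjoint_left]; intro z hz hz'; have := s5 hz'; simp_all
  -- the colours of `A1`
  obtain ⟨A1, tA1, tA2, cA1, iA1⟩ : ∃ A1 : Finset κ, Qα ⊆ A1 ∧ A1 ⊆ PAB ∪ PA ∧ A1.card = a1 ∧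
      (A1 ∩ PAB).card ≤ T - a2 := by
    rcases le_total a1 PA.card with h | h
    · obtain ⟨P, p1, p2, p3⟩ := Finset.exists_subsuperset_card_eq sα (by omega) h
      refine ⟨P, p1, p2.trans Finset.subset_union_right, p3, ?_⟩
      have : P ∩ PAB = ∅ := by
        rw [← Finset.disjoint_iff_inter_eq_empty]; exact Finset.disjoint_of_subset_left p2 dA
      rw [this]; simp
    · obtain ⟨P, p1, p2, p3⟩ := Finset.exists_subsuperset_card_eq
        (Finset.subset_union_right (s₁ := PAB) (s₂ := PA)) h (by omega)
      refine ⟨P, sα.trans p1, p2, p3, ?_⟩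
      have e : P ∩ PAB ⊆ P \ PA := by
        intro z hz
        simp only [Finset.mem_inter, Finset.mem_sdiff] at hz ⊢
        exact ⟨hz.1, fun h => Finset.disjoint_left.mp dA h hz.2⟩
      have e1 := Finset.card_le_card e
      have e2 := Finset.card_sdiff_add_card_eq_card p1
      omega
  -- the colours of `B1`
  obtain ⟨B1, tB1, tB2, cB1⟩ : ∃ B1 : Finset κ, Q1 ⊆ B1 ∧
      B1 ⊆ ((PAB ∪ PB) \ (A1 ∩ PAB)) \ (Q3 ∪ R3 ∪ R2) ∧ B1.card = b1 := by
    apply Finset.exists_subsuperset_card_eq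
    · intro z hz
      have := s1 hz
      simp only [Finset.mem_sdiff, Finset.mem_union, Finset.mem_inter]
      refine ⟨⟨Or.inr this, fun h => Finset.disjoint_left.mp dBAB this h.2⟩, ?_⟩
      rintro ((h | h) | h)
      · have := s3 h; simp_all
      · have := s4 h; simp_all
      · have := s5 h; simp_all
    · omega
    · have e1 := Finset.le_card_sdiff (A1 ∩ PAB) (PAB ∪ PB)
      have e2 := Finset.le_card_sdiff (Q3 ∪ R3 ∪ R2) ((PAB ∪ PB) \ (A1 ∩ PAB))
      omega
  have tB3 : B1 ⊆ PAB ∪ PB := tB2.trans (Finset.sdiff_subset.trans Finset.sdiff_subset)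
  have cB1' := Finset.card_sdiff_add_card_eq_card tB3
  obtain ⟨B2, uB1, uB2, cB2⟩ : ∃ B2 : Finset κ, R2 ⊆ B2 ∧
      B2 ⊆ ((PAB ∪ PB) \ B1) \ (Q3 ∪ R3) ∧ B2.card = b2 := by
    apply Finset.exists_subsuperset_card_eq
    · intro z hz
      have h5 := s5 hz
      simp only [Finset.mem_sdiff, Finset.mem_union] at h5 ⊢
      refine ⟨⟨Or.inr h5.1.1.1, fun h => ?_⟩, ?_⟩
      · have := tB2 h; simp_all
      · rintro (h | h)
        · exact h5.1.2 h
        · exact h5.2 h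
    · omega
    · have e2 := Finset.le_card_sdiff (Q3 ∪ R3) ((PAB ∪ PB) \ B1)
      omega
  have uB3 : B2 ⊆ (PAB ∪ PB) \ B1 := uB2.trans Finset.sdiff_subset
  have cB2' := Finset.card_sdiff_add_card_eq_card uB3
  -- the colours of `C1`
  have cbase : (Qα ∪ Q1 ∪ Q3).card ≤ α + β1 + β3 := by
    have e1 := Finset.card_union_le (Qα ∪ Q1) Q3
    have e2 := Finset.card_union_le Qα Q1
    omega
  obtain ⟨P0, hP0⟩ : ∃ P0, P0 = (PAB ∪ PA ∪ PB)ᶜ := ⟨_, rfl⟩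
  have d0 : ∀ z ∈ P0, z ∉ PAB ∧ z ∉ PA ∧ z ∉ PB := by
    intro z hz; rw [hP0] at hz; simp at hz; tauto
  rw [← hP0] at cU0
  have cbig : (Qα ∪ Q1 ∪ Q3 ∪ P0).card = α + β1 + β3 + P0.card := by
    rw [Finset.card_union_of_disjoint, Finset.card_union_of_disjoint,
      Finset.card_union_of_disjoint, cα, cq1, cq3]
    · rw [Finset.disjoint_left]; intro z hz hz'
      exact Finset.disjoint_left.mp dBA (s1 hz') (sα hz)
    · rw [Finset.disjoint_left]; intro z hz hz'
      have h3 := Finset.mem_sdiff.mp (s3 hz')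
      rcases Finset.mem_union.mp hz with h | h
      · exact Finset.disjoint_left.mp dBA h3.1 (sα h)
      · exact h3.2 h
    · rw [Finset.disjoint_left]; intro z hz hz'
      have := d0 z hz'
      simp only [Finset.mem_union] at hz
      rcases hz with (h | h) | h
      · exact this.2.1 (sα h)
      · exact this.2.2 (s1 h)
      · exact this.2.2 (Finset.mem_sdiff.mp (s3 h)).1
  obtain ⟨C1, vC1, vC2, cC1⟩ : ∃ C1 : Finset κ, Qα ∪ Q1 ∪ Q3 ⊆ C1 ∧
      C1 ⊆ Qα ∪ Q1 ∪ Q3 ∪ P0 ∧ C1.card = c1 := by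
    apply Finset.exists_subsuperset_card_eq Finset.subset_union_left
    · omega
    · omega
  have cC1' := Finset.card_sdiff_add_card_eq_card vC2
  obtain ⟨D, hD⟩ : ∃ D, D = (Qα ∪ Q1 ∪ Q3 ∪ P0) \ C1 := ⟨_, rfl⟩
  rw [← hD] at cC1'
  have hD1 : ∀ z ∈ D, z ∈ P0 ∧ z ∉ C1 := by
    intro z hz
    rw [hD, Finset.mem_sdiff] at hz
    refine ⟨?_, hz.2⟩
    rcases Finset.mem_union.mp hz.1 with h | h
    · exact absurd (vC1 h) hz.2
    · exact h
  have cR : (R3 ∪ R2).card = γ3 + γ2 := by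
    rw [Finset.card_union_of_disjoint, cq4, cq5]
    rw [Finset.disjoint_left]; intro z hz hz'
    exact (Finset.mem_sdiff.mp (s5 hz')).2 hz
  have cRD : (R3 ∪ R2 ∪ D).card = γ3 + γ2 + D.card := by
    rw [Finset.card_union_of_disjoint, cR]
    rw [Finset.disjoint_left]; intro z hz hz'
    have h0 := d0 z (hD1 z hz').1
    rcases Finset.mem_union.mp hz with h | h
    · have := s4 h
      simp only [Finset.mem_sdiff] at this
      exact h0.2.2 this.1.1
    · have := s5 h
      simp only [Finset.mem_sdiff] at this
      exact h0.2.2 this.1.1.1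
  obtain ⟨C2, wC1, wC2, cC2⟩ : ∃ C2 : Finset κ, R3 ∪ R2 ⊆ C2 ∧
      C2 ⊆ R3 ∪ R2 ∪ D ∧ C2.card = c2 := by
    apply Finset.exists_subsuperset_card_eq Finset.subset_union_left
    · omega
    · omega
  have cA2 := Finset.card_sdiff_add_card_eq_card tA2
  simp only [Finset.disjoint_left] at dABX dABY sA dA dBY dBAB dBA
  simp only [Finset.subset_iff, Finset.mem_union, Finset.mem_sdiff,
    Finset.mem_inter] at sα s1 s3 s4 s5 tA1 tA2 tB1 tB2 tB3 uB1 uB2 uB3 vC1 vC2 wC1 wC2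
  clear hYX hcc hPB cU0 hP0 hD
  refine ⟨A1, (PAB ∪ PA) \ A1, B1, B2, ((PAB ∪ PB) \ B1) \ B2, C1, C2,
    ⟨cA1, by omega, cB1, cB2, by omega, cC1, cC2⟩, ?_, ?_, ?_, ?_, ?_⟩
  · simp only [Finset.disjoint_left, Finset.mem_union, Finset.mem_sdiff]
    refine ⟨?_, ?_, ?_, ?_, ?_⟩ <;> grind
  · simp only [Finset.disjoint_left, Finset.mem_union, Finset.mem_sdiff]
    refine ⟨?_, ?_, ?_, ?_, ?_⟩ <;> grind
  · simp only [Finset.disjoint_left, Finset.mem_union, Finset.mem_sdiff]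
    refine ⟨?_, ?_, ?_, ?_, ?_, ?_⟩ <;> grind
  · rw [← cq3]; apply Finset.card_le_card; intro z
    simp only [Finset.mem_inter, Finset.mem_union, Finset.mem_sdiff]; grind
  · rw [← cq5]; apply Finset.card_le_card; intro z
    simp only [Finset.mem_inter]; grind

theorem strangeH_cases (i j : Fin 7) (hij : i < j) (h : strangeH.Adj i j) :
    (i = 0 ∧ j = 1) ∨ (i = 2 ∧ j = 3) ∨ (i = 2 ∧ j = 4) ∨ (i = 3 ∧ j = 4) ∨ (i = 5 ∧ j = 6) ∨ (i = 0 ∧ j = 2) ∨ (i = 1 ∧ j = 5) ∨ (i = 3 ∧ j = 5) ∨ (i = 4 ∧ j = 5) ∨ (i = 0 ∧ j = 6) ∨ (i = 1 ∧ j = 6) ∨ (i = 2 ∧ j = 6) ∨ (i = 3 ∧ j = 6) := by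
  rw [strangeH, SimpleGraph.fromEdgeSet_adj] at h
  have h1 := h.1
  simp only [Set.mem_insert_iff, Set.mem_singleton_iff, Sym2.eq_iff] at h1
  clear h
  rcases h1 with h1 | h1 | h1 | h1 | h1 | h1 | h1 | h1 | h1 | h1 | h1 | h1 | h1 <;>
    rcases h1 with ⟨rfl, rfl⟩ | ⟨rfl, rfl⟩ <;> first
      | (exact absurd hij (by decide))
      | simp

set_option maxHeartbeats 4000000 in
theorem stmt16 {V : Type*} [Fintype V] [DecidableEq V] (G : SimpleGraph V)
    (V1 V2 X1 Y1 X2 Y2 : Finset V)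
    (hsk : Skeletal G) (hcf : ClawFree G)
    (hj : IsGen2Join G V1 V2 X1 Y1 X2 Y2)
    (hstrip : IsStrangeStripOn G V2 X2 Y2)
    (l : ℕ) (hl : gammaLJ G V2 X1 Y1 ≤ l)
    (hcol : (G.induce (↑V1 : Set V)).Colorable l) :
    G.Colorable l := by
  obtain ⟨f, hf, hX2, hY2⟩ := hstrip
  have hX2' : ∀ v, v ∈ X2 ↔ v ∈ V2 ∧ (f v = 0 ∨ f v = 1) := by
    intro v; rw [← Finset.mem_coe, hX2]; rfl
  have hY2' : ∀ v, v ∈ Y2 ↔ v ∈ V2 ∧ (f v = 2 ∨ f v = 3 ∨ f v = 4) := by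
    intro v; rw [← Finset.mem_coe, hY2]; rfl
  have hV12 : ∀ v, v ∈ V1 → v ∉ V2 := fun v h h' => Finset.disjoint_left.mp hj.disjV h h'
  have hVV : ∀ v, v ∈ V1 ∨ v ∈ V2 := by
    intro v; rw [← Finset.mem_union, hj.unionV]; exact Finset.mem_univ v
  -- the fibres
  obtain ⟨F, hF⟩ : ∃ F : Fin 7 → Finset V, ∀ i v, v ∈ F i ↔ v ∈ V2 ∧ f v = i :=
    ⟨fun i => V2.filter (fun v => f v = i), fun i v => by simp⟩
  have hFne : ∀ i, (F i).Nonempty := by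
    intro i
    obtain ⟨v, hv, hvi⟩ := hf.fibers_nonempty i (Set.mem_univ i)
    exact ⟨v, (hF i v).mpr ⟨hv, hvi⟩⟩
  have hFc : ∀ i, G.IsClique (↑(F i) : Set V) := by
    intro i u hu v hv huv
    exact hf.fibers_clique i ((hF i u).mp hu) ((hF i v).mp hv) huv
  have hFd : ∀ i j, i ≠ j → Disjoint (F i) (F j) := by
    intro i j hij
    rw [Finset.disjoint_left]
    intro v hv hv'
    exact hij (((hF i v).mp hv).2.symm.trans ((hF j v).mp hv').2)
  have hFV : ∀ i, F i ⊆ V2 := fun i v hv => ((hF i v).mp hv).1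
  have hFadj : ∀ i j, strangeH.Adj i j → s(i, j) ∉ strangeM →
      ∀ u ∈ F i, ∀ v ∈ F j, G.Adj u v := by
    intro i j hij hM u hu v hv
    obtain ⟨hu1, rfl⟩ := (hF i u).mp hu
    obtain ⟨hv1, rfl⟩ := (hF j v).mp hv
    exact hf.adj_of_adj u hu1 v hv1 hij.ne hij hM
  have hX1F : ∀ i, Disjoint X1 (F i) := by
    intro i; rw [Finset.disjoint_left]
    intro v hv hv'; exact hV12 v (hj.subX1 hv) (hFV i hv')
  have hY1F : ∀ i, Disjoint Y1 (F i) := by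
    intro i; rw [Finset.disjoint_left]
    intro v hv hv'; exact hV12 v (hj.subY1 hv) (hFV i hv')
  have hFX : ∀ i, i = 0 ∨ i = 1 → ∀ u ∈ X1, ∀ v ∈ F i, G.Adj u v := by
    intro i hi u hu v hv
    obtain ⟨hv1, rfl⟩ := (hF i v).mp hv
    refine hj.cliqueX (Or.inl hu) (Or.inr ((hX2' v).mpr ⟨hv1, hi⟩)) ?_
    rintro rfl
    exact hV12 u (hj.subX1 hu) hv1
  have hFY : ∀ i, i = 2 ∨ i = 3 ∨ i = 4 → ∀ u ∈ Y1, ∀ v ∈ F i, G.Adj u v := by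
    intro i hi u hu v hv
    obtain ⟨hv1, rfl⟩ := (hF i v).mp hv
    refine hj.cliqueY (Or.inl hu) (Or.inr ((hY2' v).mpr ⟨hv1, hi⟩)) ?_
    rintro rfl
    exact hV12 u (hj.subY1 hu) hv1
  have hX1c : G.IsClique (↑X1 : Set V) := hj.cliqueX.subset Set.subset_union_left
  have hY1c : G.IsClique (↑Y1 : Set V) := hj.cliqueY.subset Set.subset_union_left
  have hFX1 : ∀ i, ∀ u ∈ F i, u ∉ X1 := fun i u hu hu' => Finset.disjoint_left.mp (hX1F i) hu' hu
  have hFY1 : ∀ i, ∀ u ∈ F i, u ∉ Y1 := fun i u hu hu' => Finset.disjoint_left.mp (hY1F i) hu' hu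
  have homog : ∀ i v, (v ∈ V1 ∨ (v ∈ V2 ∧ f v ≠ i ∧ s(f v, i) ∉ strangeM)) →
      (∀ b ∈ F i, G.Adj v b) ∨ (∀ b ∈ F i, ¬ G.Adj v b) := by
    rintro i v (hv | ⟨hv, hvi, hM⟩)
    · by_cases hA : (i = 0 ∨ i = 1) ∧ v ∈ X1
      · exact Or.inl (hFX i hA.1 v hA.2)
      by_cases hB : (i = 2 ∨ i = 3 ∨ i = 4) ∧ v ∈ Y1
      · exact Or.inl (hFY i hB.1 v hB.2)
      right
      intro b hb hvb
      obtain ⟨hb1, rfl⟩ := (hF i b).mp hb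
      rcases hj.cross v hv b hb1 hvb with h | h
      · exact hA ⟨((hX2' b).mp h.2).2, h.1⟩
      · exact hB ⟨((hY2' b).mp h.2).2, h.1⟩
    · by_cases hA : strangeH.Adj (f v) i
      · exact Or.inl (fun b hb => hFadj _ _ hA hM v ((hF _ v).mpr ⟨hv, rfl⟩) b hb)
      · right
        intro b hb
        obtain ⟨hb1, rfl⟩ := (hF i b).mp hb
        exact hf.nonadj_of_nonadj v hv b hb1 hvi hA
  -- the two skeletal pairs
  have skel : ∀ i j : Fin 7, i ≠ j → s(i, j) ∈ strangeM →
      (∀ m, m ≠ i → m ≠ j → s(m, i) ∉ strangeM ∧ s(m, j) ∉ strangeM) →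
      ∃ B' C' : Finset V, B' ⊆ F i ∧ C' ⊆ F j ∧ (∀ b ∈ B', ∀ c ∈ C', G.Adj b c) ∧
      (∀ b ∈ F i, ∀ c ∈ F j, G.Adj b c → b ∈ B' ∧ c ∈ C') ∧
      (F i).card ≤ B'.card + C'.card ∧ (F j).card ≤ B'.card + C'.card ∧
      B'.Nonempty ∧ C'.Nonempty := by
    intro i j hij hM hm
    obtain ⟨u, hu, v, hv, hui, hvj, huv⟩ := hf.semi_adj i (Set.mem_univ i) j (Set.mem_univ j) hM
    obtain ⟨u', hu', v', hv', hui', hvj', huv'⟩ :=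
      hf.semi_nonadj i (Set.mem_univ i) j (Set.mem_univ j) hM
    have mu := (hF i u).mpr ⟨hu, hui⟩
    have mv := (hF j v).mpr ⟨hv, hvj⟩
    have mu' := (hF i u').mpr ⟨hu', hui'⟩
    have mv' := (hF j v').mpr ⟨hv', hvj'⟩
    apply skelPair G (F i) (F j) (hFc i) (hFc j) (hFd i j hij) _ ⟨u, mu, v, mv, huv⟩
    apply hsk
    refine ⟨Set.subset_univ _, Set.subset_univ _, hFc i, hFc j, hFne i, hFne j, hFd i j hij,
      ?_, ?_⟩
    · by_contra hcon
      have c1 := (hFne i).card_pos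
      have c2 := (hFne j).card_pos
      have e1 : u = u' := Finset.card_le_one.mp (by omega) u mu u' mu'
      have e2 : v = v' := Finset.card_le_one.mp (by omega) v mv v' mv'
      subst e1 e2
      exact huv' huv
    · intro w _ hwi hwj
      rcases hVV w with h | h
      · exact ⟨homog i w (Or.inl h), homog j w (Or.inl h)⟩
      · have n1 : f w ≠ i := fun h' => hwi ((hF i w).mpr ⟨h, h'⟩)
        have n2 : f w ≠ j := fun h' => hwj ((hF j w).mpr ⟨h, h'⟩)
        have := hm (f w) n1 n2
        exact ⟨homog i w (Or.inr ⟨h, n1, this.1⟩), homog j w (Or.inr ⟨h, n2, this.2⟩)⟩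
  obtain ⟨B3, C1, hB3, hC1, hBC1, hBC1', k1, k2, neB3, neC1⟩ := skel 4 5 (by decide)
    (by simp [strangeM]) (by intro m; fin_cases m <;> simp [strangeM])
  obtain ⟨B2, C2, hB2, hC2, hBC2, hBC2', k3, k4, neB2, neC2⟩ := skel 3 6 (by decide)
    (by simp [strangeM]) (by intro m; fin_cases m <;> simp [strangeM])
  -- adjacency between fibres
  have ad01 := hFadj 0 1 (by simp [strangeH]) (by simp [strangeM])
  have ad23 := hFadj 2 3 (by simp [strangeH]) (by simp [strangeM])
  have ad24 := hFadj 2 4 (by simp [strangeH]) (by simp [strangeM])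
  have ad34 := hFadj 3 4 (by simp [strangeH]) (by simp [strangeM])
  have ad56 := hFadj 5 6 (by simp [strangeH]) (by simp [strangeM])
  have ad02 := hFadj 0 2 (by simp [strangeH]) (by simp [strangeM])
  have ad15 := hFadj 1 5 (by simp [strangeH]) (by simp [strangeM])
  have ad35 := hFadj 3 5 (by simp [strangeH]) (by simp [strangeM])
  have ad06 := hFadj 0 6 (by simp [strangeH]) (by simp [strangeM])
  have ad16 := hFadj 1 6 (by simp [strangeH]) (by simp [strangeM])
  have ad26 := hFadj 2 6 (by simp [strangeH]) (by simp [strangeM])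
  have hFsub : ∀ i, F i ⊆ V2 ∪ X1 ∪ Y1 := fun i v hv =>
    Finset.mem_union_left _ (Finset.mem_union_left _ (hFV i hv))
  have hXsub : X1 ⊆ V2 ∪ X1 ∪ Y1 := fun v hv =>
    Finset.mem_union_left _ (Finset.mem_union_right _ hv)
  have hYsub : Y1 ⊆ V2 ∪ X1 ∪ Y1 := fun v hv => Finset.mem_union_right _ hv
  have hsY : ∀ {P : Finset V}, P ⊆ Y1 → (∀ u ∈ P, u ∈ X1 → u ∈ Y1) := fun h u hu _ => h hu
  have hsX : ∀ {P : Finset V}, P ⊆ X1 → (∀ u ∈ P, u ∈ Y1 → u ∈ X1) := fun h u hu _ => h hu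
  have hsF : ∀ i, ∀ {P : Finset V}, P ⊆ F i →
      (∀ u ∈ P, u ∈ X1 → u ∈ Y1) ∧ (∀ u ∈ P, u ∈ Y1 → u ∈ X1) :=
    fun i P h => ⟨fun u hu h' => absurd h' (hFX1 i u (h hu)),
      fun u hu h' => absurd h' (hFY1 i u (h hu))⟩
  have hsF1 := fun i => (hsF i (Finset.Subset.refl _)).1
  have hsF2 := fun i => (hsF i (Finset.Subset.refl _)).2
  have inCl : ∀ {P : Finset V} {v : V}, G.IsClique (↑P : Set V) → v ∈ P →
      ∀ u ∈ P, u ≠ v → G.Adj v u := fun h hv u hu huv => h hv hu huv.symm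
  -- bounds at a vertex of `A2`
  obtain ⟨v1, hv1⟩ := hFne 1
  have bA := fun Ls => boundL G V2 X1 Y1 l hl v1 [X1, F 0, F 1, F 5, F 6] Ls
    (by simp [hX1F, hFd]) ⟨F 1, by simp, hv1⟩
    (by
      simp only [List.mem_cons, List.not_mem_nil, or_false, forall_eq_or_imp, forall_eq]
      exact ⟨fun u hu _ => (hFX 1 (Or.inr rfl) u hu v1 hv1).symm,
        fun u hu _ => (ad01 u hu v1 hv1).symm, inCl (hFc 1) hv1,
        fun u hu _ => ad15 v1 hv1 u hu, fun u hu _ => ad16 v1 hv1 u hu⟩)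
  have I1 := bA [X1, F 0, F 1] ⟨F 1, by simp, hv1⟩ (by simp [hX1c, hFc])
    (by
      simp only [List.pairwise_cons, List.mem_cons, List.not_mem_nil, or_false, forall_eq_or_imp, forall_eq,
        false_imp_iff, implies_true, List.Pairwise.nil, and_true]
      exact ⟨⟨hFX 0 (Or.inl rfl), hFX 1 (Or.inr rfl)⟩, ad01⟩)
    (by
      simp only [List.mem_cons, List.not_mem_nil, or_false, forall_eq_or_imp, forall_eq]
      exact ⟨hXsub, hFsub 0, hFsub 1⟩)
    (Or.inr (by
      simp only [List.mem_cons, List.not_mem_nil, or_false, forall_eq_or_imp, forall_eq]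
      exact ⟨hsX (Finset.Subset.refl _), hsF2 0, hsF2 1⟩))
  have I2 := bA [F 0, F 1, F 6] ⟨F 1, by simp, hv1⟩ (by simp [hFc])
    (by
      simp only [List.pairwise_cons, List.mem_cons, List.not_mem_nil, or_false, forall_eq_or_imp, forall_eq,
        false_imp_iff, implies_true, List.Pairwise.nil, and_true]
      exact ⟨⟨ad01, ad06⟩, ad16⟩)
    (by
      simp only [List.mem_cons, List.not_mem_nil, or_false, forall_eq_or_imp, forall_eq]
      exact ⟨hFsub 0, hFsub 1, hFsub 6⟩)
    (Or.inr (by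
      simp only [List.mem_cons, List.not_mem_nil, or_false, forall_eq_or_imp, forall_eq]
      exact ⟨hsF2 0, hsF2 1, hsF2 6⟩))
  have I3 := bA [F 1, F 5, F 6] ⟨F 1, by simp, hv1⟩ (by simp [hFc])
    (by
      simp only [List.pairwise_cons, List.mem_cons, List.not_mem_nil, or_false, forall_eq_or_imp, forall_eq,
        false_imp_iff, implies_true, List.Pairwise.nil, and_true]
      exact ⟨⟨ad15, ad16⟩, ad56⟩)
    (by
      simp only [List.mem_cons, List.not_mem_nil, or_false, forall_eq_or_imp, forall_eq]
      exact ⟨hFsub 1, hFsub 5, hFsub 6⟩)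
    (Or.inr (by
      simp only [List.mem_cons, List.not_mem_nil, or_false, forall_eq_or_imp, forall_eq]
      exact ⟨hsF2 1, hsF2 5, hsF2 6⟩))
  -- bounds at a vertex of `B2`
  obtain ⟨v3, hv3'⟩ := neB2
  have hv3 := hB2 hv3'
  have hdC2 : ∀ i, i ≠ 6 → Disjoint (F i) C2 := fun i hi =>
    Finset.disjoint_of_subset_right hC2 (hFd i 6 hi)
  have hC2c : G.IsClique (↑C2 : Set V) := (hFc 6).subset (by exact_mod_cast hC2)
  have hC1c : G.IsClique (↑C1 : Set V) := (hFc 5).subset (by exact_mod_cast hC1)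
  have hB2c : G.IsClique (↑B2 : Set V) := (hFc 3).subset (by exact_mod_cast hB2)
  have hB3c : G.IsClique (↑B3 : Set V) := (hFc 4).subset (by exact_mod_cast hB3)
  have hYC2 : Disjoint Y1 C2 := Finset.disjoint_of_subset_right hC2 (hY1F 6)
  have bB := fun Ls => boundL G V2 X1 Y1 l hl v3 [Y1, F 2, F 3, F 4, F 5, C2] Ls
    (by simp [hY1F, hFd, hdC2, hYC2]) ⟨F 3, by simp, hv3⟩
    (by
      simp only [List.mem_cons, List.not_mem_nil, or_false, forall_eq_or_imp, forall_eq]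
      exact ⟨fun u hu _ => (hFY 3 (Or.inr (Or.inl rfl)) u hu v3 hv3).symm,
        fun u hu _ => (ad23 u hu v3 hv3).symm, inCl (hFc 3) hv3,
        fun u hu _ => ad34 v3 hv3 u hu, fun u hu _ => ad35 v3 hv3 u hu,
        fun u hu _ => hBC2 v3 hv3' u hu⟩)
  have J1 := bB [Y1, F 2, F 3, F 4] ⟨F 3, by simp, hv3⟩ (by simp [hY1c, hFc])
    (by
      simp only [List.pairwise_cons, List.mem_cons, List.not_mem_nil, or_false, forall_eq_or_imp, forall_eq,
        false_imp_iff, implies_true, List.Pairwise.nil, and_true]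
      exact ⟨⟨hFY 2 (Or.inl rfl), hFY 3 (Or.inr (Or.inl rfl)), hFY 4 (Or.inr (Or.inr rfl))⟩,
        ⟨ad23, ad24⟩, ad34⟩)
    (by
      simp only [List.mem_cons, List.not_mem_nil, or_false, forall_eq_or_imp, forall_eq]
      exact ⟨hYsub, hFsub 2, hFsub 3, hFsub 4⟩)
    (Or.inl (by
      simp only [List.mem_cons, List.not_mem_nil, or_false, forall_eq_or_imp, forall_eq]
      exact ⟨hsY (Finset.Subset.refl _), hsF1 2, hsF1 3, hsF1 4⟩))
  have J3 := bB [B2, F 5, C2] ⟨B2, by simp, hv3'⟩ (by simp [hFc, hB2c, hC2c])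
    (by
      simp only [List.pairwise_cons, List.mem_cons, List.not_mem_nil, or_false, forall_eq_or_imp, forall_eq,
        false_imp_iff, implies_true, List.Pairwise.nil, and_true]
      exact ⟨⟨fun u hu => ad35 u (hB2 hu), hBC2⟩, fun u hu w hw => ad56 u hu w (hC2 hw)⟩)
    (by
      simp only [List.mem_cons, List.not_mem_nil, or_false, forall_eq_or_imp, forall_eq]
      exact ⟨hB2.trans (hFsub 3), hFsub 5, hC2.trans (hFsub 6)⟩)
    (Or.inr (by
      simp only [List.mem_cons, List.not_mem_nil, or_false, forall_eq_or_imp, forall_eq]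
      exact ⟨(hsF 3 hB2).2, hsF2 5, (hsF 6 hC2).2⟩))
  have J4 := bB [F 2, B2, C2] ⟨B2, by simp, hv3'⟩ (by simp [hFc, hB2c, hC2c])
    (by
      simp only [List.pairwise_cons, List.mem_cons, List.not_mem_nil, or_false, forall_eq_or_imp, forall_eq,
        false_imp_iff, implies_true, List.Pairwise.nil, and_true]
      exact ⟨⟨fun u hu w hw => ad23 u hu w (hB2 hw), fun u hu w hw => ad26 u hu w (hC2 hw)⟩, hBC2⟩)
    (by
      simp only [List.mem_cons, List.not_mem_nil, or_false, forall_eq_or_imp, forall_eq]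
      exact ⟨hFsub 2, hB2.trans (hFsub 3), hC2.trans (hFsub 6)⟩)
    (Or.inr (by
      simp only [List.mem_cons, List.not_mem_nil, or_false, forall_eq_or_imp, forall_eq]
      exact ⟨hsF2 2, (hsF 3 hB2).2, (hsF 6 hC2).2⟩))
  have J5 := bB [F 3, B3, C1] ⟨F 3, by simp, hv3⟩ (by simp [hFc, hB3c, hC1c])
    (by
      simp only [List.pairwise_cons, List.mem_cons, List.not_mem_nil, or_false, forall_eq_or_imp, forall_eq,
        false_imp_iff, implies_true, List.Pairwise.nil, and_true]
      exact ⟨⟨fun u hu w hw => ad34 u hu w (hB3 hw), fun u hu w hw => ad35 u hu w (hC1 hw)⟩, hBC1⟩)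
    (by
      simp only [List.mem_cons, List.not_mem_nil, or_false, forall_eq_or_imp, forall_eq]
      exact ⟨hFsub 3, hB3.trans (hFsub 4), hC1.trans (hFsub 5)⟩)
    (Or.inr (by
      simp only [List.mem_cons, List.not_mem_nil, or_false, forall_eq_or_imp, forall_eq]
      exact ⟨hsF2 3, (hsF 4 hB3).2, (hsF 5 hC1).2⟩))
  -- bounds at a vertex of `A1`
  obtain ⟨v0, hv0⟩ := hFne 0
  have cl := boundL G V2 X1 Y1 l hl v0 [F 0, F 2, F 6] [F 0, F 2, F 6]
    (by simp [hFd]) ⟨F 0, by simp, hv0⟩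
    (by
      simp only [List.mem_cons, List.not_mem_nil, or_false, forall_eq_or_imp, forall_eq]
      exact ⟨inCl (hFc 0) hv0, fun u hu _ => ad02 v0 hv0 u hu, fun u hu _ => ad06 v0 hv0 u hu⟩)
    ⟨F 0, by simp, hv0⟩ (by simp [hFc])
    (by
      simp only [List.pairwise_cons, List.mem_cons, List.not_mem_nil, or_false, forall_eq_or_imp, forall_eq,
        false_imp_iff, implies_true, List.Pairwise.nil, and_true]
      exact ⟨⟨ad02, ad06⟩, ad26⟩)
    (by
      simp only [List.mem_cons, List.not_mem_nil, or_false, forall_eq_or_imp, forall_eq]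
      exact ⟨hFsub 0, hFsub 2, hFsub 6⟩)
    (Or.inr (by
      simp only [List.mem_cons, List.not_mem_nil, or_false, forall_eq_or_imp, forall_eq]
      exact ⟨hsF2 0, hsF2 2, hsF2 6⟩))
  have hZX : X1 ∩ Y1 ⊆ X1 := Finset.inter_subset_left
  have hZY : X1 ∩ Y1 ⊆ Y1 := Finset.inter_subset_right
  have hZd : ∀ i, Disjoint (F i) (X1 ∩ Y1) := fun i =>
    (Finset.disjoint_of_subset_left hZX (hX1F i)).symm
  have zz := boundL G V2 X1 Y1 l hl v0 [F 0, F 2, X1 ∩ Y1] [F 0, F 2, X1 ∩ Y1]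
    (by simp [hFd, hZd]) ⟨F 0, by simp, hv0⟩
    (by
      simp only [List.mem_cons, List.not_mem_nil, or_false, forall_eq_or_imp, forall_eq]
      exact ⟨inCl (hFc 0) hv0, fun u hu _ => ad02 v0 hv0 u hu,
        fun u hu _ => (hFX 0 (Or.inl rfl) u (hZX hu) v0 hv0).symm⟩)
    ⟨F 0, by simp, hv0⟩ (by
      simp only [List.mem_cons, List.not_mem_nil, or_false, forall_eq_or_imp, forall_eq]
      exact ⟨hFc 0, hFc 2, hX1c.subset (by exact_mod_cast hZX)⟩)
    (by
      simp only [List.pairwise_cons, List.mem_cons, List.not_mem_nil, or_false, forall_eq_or_imp, forall_eq,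
        false_imp_iff, implies_true, List.Pairwise.nil, and_true]
      exact ⟨⟨ad02, fun u hu w hw => (hFX 0 (Or.inl rfl) w (hZX hw) u hu).symm⟩,
        fun u hu w hw => (hFY 2 (Or.inl rfl) w (hZY hw) u hu).symm⟩)
    (by simp only [List.mem_cons, List.not_mem_nil, or_false, forall_eq_or_imp, forall_eq]
        exact ⟨hFsub 0, hFsub 2, hZX.trans hXsub⟩)
    (Or.inr (by
      simp only [List.mem_cons, List.not_mem_nil, or_false, forall_eq_or_imp, forall_eq]
      exact ⟨hsF2 0, hsF2 2, hsX hZX⟩))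
  simp only [List.map_cons, List.map_nil, List.sum_cons, List.sum_nil] at I1 I2 I3 J1 J3 J4 J5 cl zz
  -- the colouring of `G1`
  have hl0 : 0 < l := by have := (hFne 0).card_pos; omega
  obtain ⟨col0, hcol0⟩ : ∃ col : V → Fin l, ProperOn G V1 col := by
    obtain ⟨c⟩ := hcol
    refine ⟨fun v => if h : v ∈ V1 then c ⟨v, h⟩ else ⟨0, hl0⟩, ?_⟩
    intro u hu v hv huv
    simp only [hu, hv, dif_pos]
    exact c.valid (by simpa using huv)
  have hU : ∀ u ∈ X1, u ∉ Y1 → ∀ N : Finset V, (∀ w ∈ N, G.Adj u w ∧ w ∈ V1 ∧ w ∉ X1) →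
      2 * (X1.card + ((F 0).card + (F 1).card)) + N.card ≤ 2 * l := by
    intro u hu _ N hN
    have := boundL G V2 X1 Y1 l hl u [X1, F 0, F 1, N] [X1, F 0, F 1]
      (by
        have h1 : Disjoint X1 N := by
          rw [Finset.disjoint_left]; intro w hw hw'; exact (hN w hw').2.2 hw
        have h2 : ∀ i, Disjoint (F i) N := by
          intro i; rw [Finset.disjoint_left]; intro w hw hw'
          exact hV12 w (hN w hw').2.1 (hFV i hw)
        simp [hX1F, hFd, h1, h2]) ⟨X1, by simp, hu⟩
      (by
        simp only [List.mem_cons, List.not_mem_nil, or_false, forall_eq_or_imp, forall_eq]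
        exact ⟨inCl hX1c hu, fun w hw _ => hFX 0 (Or.inl rfl) u hu w hw,
          fun w hw _ => hFX 1 (Or.inr rfl) u hu w hw, fun w hw _ => (hN w hw).1⟩)
      ⟨X1, by simp, hu⟩ (by simp [hX1c, hFc])
      (by
        simp only [List.pairwise_cons, List.mem_cons, List.not_mem_nil, or_false, forall_eq_or_imp, forall_eq,
          false_imp_iff, implies_true, List.Pairwise.nil, and_true]
        exact ⟨⟨hFX 0 (Or.inl rfl), hFX 1 (Or.inr rfl)⟩, ad01⟩)
      (by
        simp only [List.mem_cons, List.not_mem_nil, or_false, forall_eq_or_imp, forall_eq]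
        exact ⟨hXsub, hFsub 0, hFsub 1⟩)
      (Or.inr (by
        simp only [List.mem_cons, List.not_mem_nil, or_false, forall_eq_or_imp, forall_eq]
        exact ⟨hsX (Finset.Subset.refl _), hsF2 0, hsF2 1⟩))
    simp only [List.map_cons, List.map_nil, List.sum_cons, List.sum_nil] at this
    omega
  have hV : ∀ u ∈ Y1, u ∉ X1 → ∀ N : Finset V, (∀ w ∈ N, G.Adj u w ∧ w ∈ V1 ∧ w ∉ Y1) →
      2 * (Y1.card + ((F 2).card + (F 3).card + (F 4).card)) + N.card ≤ 2 * l := by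
    intro u hu _ N hN
    have := boundL G V2 X1 Y1 l hl u [Y1, F 2, F 3, F 4, N] [Y1, F 2, F 3, F 4]
      (by
        have h1 : Disjoint Y1 N := by
          rw [Finset.disjoint_left]; intro w hw hw'; exact (hN w hw').2.2 hw
        have h2 : ∀ i, Disjoint (F i) N := by
          intro i; rw [Finset.disjoint_left]; intro w hw hw'
          exact hV12 w (hN w hw').2.1 (hFV i hw)
        simp [hY1F, hFd, h1, h2]) ⟨Y1, by simp, hu⟩
      (by
        simp only [List.mem_cons, List.not_mem_nil, or_false, forall_eq_or_imp, forall_eq]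
        exact ⟨inCl hY1c hu, fun w hw _ => hFY 2 (Or.inl rfl) u hu w hw,
          fun w hw _ => hFY 3 (Or.inr (Or.inl rfl)) u hu w hw,
          fun w hw _ => hFY 4 (Or.inr (Or.inr rfl)) u hu w hw, fun w hw _ => (hN w hw).1⟩)
      ⟨Y1, by simp, hu⟩ (by simp [hY1c, hFc])
      (by
        simp only [List.pairwise_cons, List.mem_cons, List.not_mem_nil, or_false, forall_eq_or_imp, forall_eq,
          false_imp_iff, implies_true, List.Pairwise.nil, and_true]
        exact ⟨⟨hFY 2 (Or.inl rfl), hFY 3 (Or.inr (Or.inl rfl)), hFY 4 (Or.inr (Or.inr rfl))⟩,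
          ⟨ad23, ad24⟩, ad34⟩)
      (by
        simp only [List.mem_cons, List.not_mem_nil, or_false, forall_eq_or_imp, forall_eq]
        exact ⟨hYsub, hFsub 2, hFsub 3, hFsub 4⟩)
      (Or.inl (by
        simp only [List.mem_cons, List.not_mem_nil, or_false, forall_eq_or_imp, forall_eq]
        exact ⟨hsY (Finset.Subset.refl _), hsF1 2, hsF1 3, hsF1 4⟩))
    simp only [List.map_cons, List.map_nil, List.sum_cons, List.sum_nil] at this
    omega
  obtain ⟨col, hp, hM⟩ := recolour G V1 X1 Y1 hj.subX1 hX1c hj.subY1 hY1c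
    ((F 0).card + (F 1).card) ((F 2).card + (F 3).card + (F 4).card) (F 0).card (F 2).card
    (by omega) (by omega) (by omega) hU hV _ col0 hcol0 rfl
  have hx := Finset.card_image_of_injOn (injOn_of_clique G V1 X1 col hp hj.subX1 hX1c)
  have hy := Finset.card_image_of_injOn (injOn_of_clique G V1 Y1 col hp hj.subY1 hY1c)
  have hun := Finset.card_union_add_card_inter (X1.image col) (Y1.image col)
  have hun2 : (X1.image col ∪ Y1.image col).card ≤ l := by
    simpa using Finset.card_le_univ (X1.image col ∪ Y1.image col)
  have hk1 := Finset.card_le_card (Finset.inter_subset_left (s₁ := X1.image col) (s₂ := Y1.image col))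
  have hk2 := Finset.card_le_card (Finset.inter_subset_right (s₁ := X1.image col) (s₂ := Y1.image col))
  have q2 := Finset.card_sdiff_add_card_eq_card hB2
  have q3 := Finset.card_sdiff_add_card_eq_card hB3
  have r1 := Finset.card_sdiff_add_card_eq_card hC1
  have r2 := Finset.card_sdiff_add_card_eq_card hC2
  obtain ⟨α, β1, β3, γ3, γ2, T, t1, t2, t3, t4, t5, t6, t7, t8, t9, t10, t11, t12, t13, t14⟩ :=
    arith (F 0).card (F 1).card (F 2).card B2.card (F 3 \ B2).card B3.card (F 4 \ B3).card
      C1.card (F 5 \ C1).card C2.card (F 6 \ C2).card X1.card Y1.card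
      (X1.image col ∩ Y1.image col).card l (by omega) (by omega) (by omega) (by omega)
      (by omega) (by omega) (by omega) (by omega) (by omega) (by omega) (by omega) (by omega)
      (by omega) (by omega) (by omega) (by omega)
  obtain ⟨S0, S1, S2, S3, S4, S5, S6, ⟨e0, e1, e2, e3, e4, e5, e6⟩, ⟨x0, x1, y2, y3, y4⟩,
      ⟨d01, d23, d24, d34, d56⟩, ⟨d02, d15, d35, d06, d16, d26⟩, i45, i36⟩ :=
    colourSets (X1.image col) (Y1.image col) (F 0).card (F 1).card (F 2).card (F 3).card
      (F 4).card (F 5).card (F 6).card X1.card Y1.card (X1.image col ∩ Y1.image col).card l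
      α β1 β3 γ3 γ2 T (Fintype.card_fin l) hx hy rfl (by omega) (by omega) t1 (by omega) t3
      (by omega) (by omega) (by omega) t9 (by omega) (by omega) t12 (by omega) (by omega)
  obtain ⟨g0, j0, m0⟩ := exists_injOn_maps (⟨0, hl0⟩ : Fin l) (F 0) S0 e0.symm
  obtain ⟨g1, j1, m1⟩ := exists_injOn_maps (⟨0, hl0⟩ : Fin l) (F 1) S1 e1.symm
  obtain ⟨g2, j2, m2⟩ := exists_injOn_maps (⟨0, hl0⟩ : Fin l) (F 2) S2 e2.symm
  obtain ⟨g4, g5, j4, m4, j5, m5, n45⟩ := refinePair (⟨0, hl0⟩ : Fin l) G (F 4) (F 5) B3 C1 S4 S5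
    hBC1' e4.symm e5.symm (by omega)
  obtain ⟨g3, g6, j3, m3, j6, m6, n36⟩ := refinePair (⟨0, hl0⟩ : Fin l) G (F 3) (F 6) B2 C2 S3 S6
    hBC2' e3.symm e6.symm (by omega)
  -- assembling the colouring
  obtain ⟨g, hg⟩ : ∃ g : Fin 7 → V → Fin l, g = ![g0, g1, g2, g3, g4, g5, g6] := ⟨_, rfl⟩
  obtain ⟨S, hS⟩ : ∃ S : Fin 7 → Finset (Fin l), S = ![S0, S1, S2, S3, S4, S5, S6] := ⟨_, rfl⟩
  have hgm : ∀ i, ∀ v ∈ F i, g i v ∈ S i := by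
    intro i; subst hg hS; fin_cases i
    exacts [m0, m1, m2, m3, m4, m5, m6]
  have hgi : ∀ i, Set.InjOn (g i) (↑(F i) : Set V) := by
    intro i; subst hg; fin_cases i
    exacts [j0, j1, j2, j3, j4, j5, j6]
  have hSd : ∀ i j, i < j → strangeH.Adj i j →
      (i = 4 ∧ j = 5) ∨ (i = 3 ∧ j = 6) ∨ Disjoint (S i) (S j) := by
    intro i j hij h
    subst hS
    rcases strangeH_cases i j hij h with ⟨rfl, rfl⟩ |
      ⟨rfl, rfl⟩ |
      ⟨rfl, rfl⟩ |
      ⟨rfl, rfl⟩ |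
      ⟨rfl, rfl⟩ |
      ⟨rfl, rfl⟩ |
      ⟨rfl, rfl⟩ |
      ⟨rfl, rfl⟩ |
      ⟨rfl, rfl⟩ |
      ⟨rfl, rfl⟩ |
      ⟨rfl, rfl⟩ |
      ⟨rfl, rfl⟩ |
      ⟨rfl, rfl⟩
    · exact Or.inr (Or.inr d01)
    · exact Or.inr (Or.inr d23)
    · exact Or.inr (Or.inr d24)
    · exact Or.inr (Or.inr d34)
    · exact Or.inr (Or.inr d56)
    · exact Or.inr (Or.inr d02)
    · exact Or.inr (Or.inr d15)
    · exact Or.inr (Or.inr d35)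
    · exact Or.inl ⟨rfl, rfl⟩
    · exact Or.inr (Or.inr d06)
    · exact Or.inr (Or.inr d16)
    · exact Or.inr (Or.inr d26)
    · exact Or.inr (Or.inl ⟨rfl, rfl⟩)
  have hpair : ∀ i j, i < j → ∀ u ∈ F i, ∀ v ∈ F j, G.Adj u v → g i u ≠ g j v := by
    intro i j hij u hu v hv huv
    have hH : strangeH.Adj i j := by
      by_contra hH
      obtain ⟨hu1, rfl⟩ := (hF i u).mp hu
      obtain ⟨hv1, rfl⟩ := (hF j v).mp hv
      exact hf.nonadj_of_nonadj u hu1 v hv1 hij.ne hH huv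
    rcases hSd i j hij hH with ⟨rfl, rfl⟩ | ⟨rfl, rfl⟩ | h
    · subst hg; exact n45 u hu v hv huv
    · subst hg; exact n36 u hu v hv huv
    · intro he
      exact Finset.disjoint_left.mp h (hgm i u hu) (he ▸ hgm j v hv)
  have hSX : ∀ i, i = 0 ∨ i = 1 → Disjoint (S i) (X1.image col) := by
    rintro i (rfl | rfl) <;> subst hS
    exacts [x0, x1]
  have hSY : ∀ i, i = 2 ∨ i = 3 ∨ i = 4 → Disjoint (S i) (Y1.image col) := by
    rintro i (rfl | rfl | rfl) <;> subst hS
    exacts [y2, y3, y4]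
  have hcross : ∀ u ∈ V1, ∀ v ∈ V2, G.Adj u v → col u ≠ g (f v) v := by
    intro u hu v hv huv he
    have hvF := (hF (f v) v).mpr ⟨hv, rfl⟩
    have hm := hgm _ v hvF
    rw [← he] at hm
    rcases hj.cross u hu v hv huv with h | h
    · exact Finset.disjoint_left.mp (hSX _ ((hX2' v).mp h.2).2) hm (Finset.mem_image_of_mem _ h.1)
    · exact Finset.disjoint_left.mp (hSY _ ((hY2' v).mp h.2).2) hm (Finset.mem_image_of_mem _ h.1)
  refine ⟨SimpleGraph.Coloring.mk (fun v => if v ∈ V1 then col v else g (f v) v) ?_⟩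
  intro u v huv
  by_cases hu : u ∈ V1 <;> by_cases hv : v ∈ V1 <;> simp only [hu, hv, if_true, if_false]
  · exact hp u hu v hv huv
  · exact hcross u hu v ((hVV v).resolve_left hv) huv
  · exact (hcross v hv u ((hVV u).resolve_left hu) huv.symm).symm
  · have huF := (hF (f u) u).mpr ⟨(hVV u).resolve_left hu, rfl⟩
    have hvF := (hF (f v) v).mpr ⟨(hVV v).resolve_left hv, rfl⟩
    rcases lt_trichotomy (f u) (f v) with h | h | h
    · exact hpair _ _ h u huF v hvF huv
    · rw [← h] at hvF ⊢
      intro he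
      exact huv.ne (hgi _ huF hvF he)
    · exact (hpair _ _ h v hvF u huF huv.symm).symm

end Paper
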